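/- arXiv:math/0609291 — 2 statements merged into one kernel-verified Lean document; each statement's English description precedes it below -/
import Mathlib

section
/- Let C be a semidualizing module over a commutative noetherian ring R. Then the pair (A_C, (A_C)^⊥) is a perfect cotorsion pair: it is a cotorsion pair, every R-module has an A_C-cover, and every R-module has an (A_C)^⊥-envelope. -/
/-!
Common definitions: Ext/Tor vanishing, semidualizing modules, the Auslander and Bass
classes, (pre)covers and (pre)envelopes, cotorsion pairs, the classes `I_C` and `F_C`,
purity, and Kaplansky classes.
-/

open CategoryTheory

universe u

noncomputable section

/-- `Ext^j_R(A,B) = 0`. -/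
def extVanishes (R : Type u) [CommRing R] (A B : ModuleCat.{u} R) (j : ℕ) : Prop :=
  Subsingleton (((Ext R (ModuleCat.{u} R) j).obj (Opposite.op A)).obj B)

/-- `Tor_j^R(A,B) = 0`. -/
def torVanishes (R : Type u) [CommRing R] (A B : ModuleCat.{u} R) (j : ℕ) : Prop :=
  Subsingleton (((Tor (ModuleCat.{u} R) j).obj A).obj B)

/-- A semidualizing module: finitely generated, `Ext^j(C,C) = 0` for all `j > 0`, and the
homothety map `χ_C : R → Hom_R(C,C)`, `r ↦ r • id`, is an isomorphism (bijective). -/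
def IsSemidualizing (R : Type u) [CommRing R] (C : Type u) [AddCommGroup C] [Module R C] :
    Prop :=
  Module.Finite R C ∧
  (∀ j : ℕ, 0 < j → extVanishes R (ModuleCat.of R C) (ModuleCat.of R C) j) ∧
  Function.Bijective (fun r : R => r • (LinearMap.id : C →ₗ[R] C))

/-- The natural map `η_M : M → Hom_R(C, C ⊗_R M)`, `m ↦ (c ↦ c ⊗ m)`. -/
def etaMap (R : Type u) [CommRing R] (C : Type u) [AddCommGroup C] [Module R C]
    (M : Type u) [AddCommGroup M] [Module R M] :
    M →ₗ[R] (C →ₗ[R] TensorProduct R C M) :=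
  (TensorProduct.mk R C M).flip

/-- The evaluation map `ε_N : C ⊗_R Hom_R(C,N) → N`, `c ⊗ f ↦ f c`. -/
def epsMap (R : Type u) [CommRing R] (C : Type u) [AddCommGroup C] [Module R C]
    (N : Type u) [AddCommGroup N] [Module R N] :
    TensorProduct R C (C →ₗ[R] N) →ₗ[R] N :=
  TensorProduct.lift (LinearMap.id (R := R) (M := C →ₗ[R] N)).flip

/-- Membership in the Auslander class `A_C`. -/
def memAuslander (R : Type u) [CommRing R] (C : Type u) [AddCommGroup C] [Module R C]
    (M : ModuleCat.{u} R) : Prop :=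
  (∀ j : ℕ, 0 < j → torVanishes R (ModuleCat.of R C) M j) ∧
  (∀ j : ℕ, 0 < j →
    extVanishes R (ModuleCat.of R C) (ModuleCat.of R (TensorProduct R C M)) j) ∧
  Function.Bijective (etaMap R C M)

/-- Membership in the Bass class `B_C`. -/
def memBass (R : Type u) [CommRing R] (C : Type u) [AddCommGroup C] [Module R C]
    (N : ModuleCat.{u} R) : Prop :=
  (∀ j : ℕ, 0 < j → extVanishes R (ModuleCat.of R C) N j) ∧
  (∀ j : ℕ, 0 < j →
    torVanishes R (ModuleCat.of R C) (ModuleCat.of R (C →ₗ[R] N)) j) ∧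
  Function.Bijective (epsMap R C N)

/-- The Auslander class `A_C` as a class of modules. -/
def auslanderClass (R : Type u) [CommRing R] (C : Type u) [AddCommGroup C] [Module R C] :
    Set (ModuleCat.{u} R) :=
  {M | memAuslander R C M}

/-- The Bass class `B_C` as a class of modules. -/
def bassClass (R : Type u) [CommRing R] (C : Type u) [AddCommGroup C] [Module R C] :
    Set (ModuleCat.{u} R) :=
  {N | memBass R C N}

variable (R : Type u) [CommRing R]

/-- `φ : F → M` is an `𝓕`-precover of `M`. -/
def IsPrecover (𝓕 : Set (ModuleCat.{u} R)) {F M : ModuleCat.{u} R} (φ : F ⟶ M) : Prop :=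
  F ∈ 𝓕 ∧ ∀ F' ∈ 𝓕, ∀ φ' : F' ⟶ M, ∃ ψ : F' ⟶ F, ψ ≫ φ = φ'

/-- `φ : F → M` is an `𝓕`-cover of `M`. -/
def IsCover (𝓕 : Set (ModuleCat.{u} R)) {F M : ModuleCat.{u} R} (φ : F ⟶ M) : Prop :=
  IsPrecover R 𝓕 φ ∧ ∀ f : F ⟶ F, f ≫ φ = φ → IsIso f

/-- `φ : M → F` is an `𝓕`-preenvelope of `M`. -/
def IsPreenvelope (𝓕 : Set (ModuleCat.{u} R)) {M F : ModuleCat.{u} R} (φ : M ⟶ F) : Prop :=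
  F ∈ 𝓕 ∧ ∀ F' ∈ 𝓕, ∀ φ' : M ⟶ F', ∃ ψ : F ⟶ F', φ ≫ ψ = φ'

/-- `φ : M → F` is an `𝓕`-envelope of `M`. -/
def IsEnvelope (𝓕 : Set (ModuleCat.{u} R)) {M F : ModuleCat.{u} R} (φ : M ⟶ F) : Prop :=
  IsPreenvelope R 𝓕 φ ∧ ∀ f : F ⟶ F, φ ≫ f = φ → IsIso f

/-- The class `𝓕` is precovering. -/
def Precovering (𝓕 : Set (ModuleCat.{u} R)) : Prop :=
  ∀ M : ModuleCat.{u} R, ∃ (F : ModuleCat.{u} R) (φ : F ⟶ M), IsPrecover R 𝓕 φ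

/-- The class `𝓕` is covering. -/
def Covering (𝓕 : Set (ModuleCat.{u} R)) : Prop :=
  ∀ M : ModuleCat.{u} R, ∃ (F : ModuleCat.{u} R) (φ : F ⟶ M), IsCover R 𝓕 φ

/-- The class `𝓕` is preenveloping. -/
def Preenveloping (𝓕 : Set (ModuleCat.{u} R)) : Prop :=
  ∀ M : ModuleCat.{u} R, ∃ (F : ModuleCat.{u} R) (φ : M ⟶ F), IsPreenvelope R 𝓕 φ

/-- The class `𝓕` is enveloping. -/
def Enveloping (𝓕 : Set (ModuleCat.{u} R)) : Prop :=
  ∀ M : ModuleCat.{u} R, ∃ (F : ModuleCat.{u} R) (φ : M ⟶ F), IsEnvelope R 𝓕 φ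

/-- `𝓕^⊥ = {N | Ext^1(F,N) = 0 for all F ∈ 𝓕}`. -/
def rightPerp (𝓕 : Set (ModuleCat.{u} R)) : Set (ModuleCat.{u} R) :=
  {N | ∀ F ∈ 𝓕, extVanishes R F N 1}

/-- `^⊥𝓖 = {M | Ext^1(M,G) = 0 for all G ∈ 𝓖}`. -/
def leftPerp (𝓖 : Set (ModuleCat.{u} R)) : Set (ModuleCat.{u} R) :=
  {M | ∀ G ∈ 𝓖, extVanishes R M G 1}

/-- `(𝓕, 𝓖)` is a cotorsion pair. -/
def IsCotorsionPair (𝓕 𝓖 : Set (ModuleCat.{u} R)) : Prop :=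
  rightPerp R 𝓕 = 𝓖 ∧ leftPerp R 𝓖 = 𝓕

/-- `(𝓕, 𝓖)` is a perfect cotorsion pair: a cotorsion pair with `𝓕` covering and
`𝓖` enveloping. -/
def IsPerfectCotorsionPair (𝓕 𝓖 : Set (ModuleCat.{u} R)) : Prop :=
  IsCotorsionPair R 𝓕 𝓖 ∧ Covering R 𝓕 ∧ Enveloping R 𝓖

variable (C : Type u) [AddCommGroup C] [Module R C]

/-- The class `I_C` of modules isomorphic to `Hom_R(C, I)` for an injective module `I`. -/
def memIC (V : ModuleCat.{u} R) : Prop :=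
  ∃ I : ModuleCat.{u} R, Module.Injective R I ∧ Nonempty (V ≃ₗ[R] (C →ₗ[R] I))

/-- The class `F_C` of modules isomorphic to `C ⊗_R F` for a flat module `F`. -/
def memFC (V : ModuleCat.{u} R) : Prop :=
  ∃ F : ModuleCat.{u} R, Module.Flat R F ∧ Nonempty (V ≃ₗ[R] TensorProduct R C F)

/-- A short exact sequence `0 → A → B → D → 0` (given by `f` and `g`) is pure exact:
it is exact and remains exact after applying `P ⊗_R −` for every `R`-module `P`. -/
def IsPureExactSeq {A B D : Type u} [AddCommGroup A] [Module R A] [AddCommGroup B]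
    [Module R B] [AddCommGroup D] [Module R D] (f : A →ₗ[R] B) (g : B →ₗ[R] D) : Prop :=
  Function.Injective f ∧ Function.Exact f g ∧ Function.Surjective g ∧
  ∀ (P : Type u) [AddCommGroup P] [Module R P],
    Function.Injective (LinearMap.lTensor P f) ∧
    Function.Exact (LinearMap.lTensor P f) (LinearMap.lTensor P g) ∧
    Function.Surjective (LinearMap.lTensor P g)

/-- A submodule is pure if tensoring the inclusion with any module keeps it injective. -/
def IsPureSubmodule {E : Type u} [AddCommGroup E] [Module R E] (A : Submodule R E) : Prop :=
  ∀ (P : Type u) [AddCommGroup P] [Module R P],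
    Function.Injective (LinearMap.lTensor P A.subtype)

/-- `𝓕` is a Kaplansky class. -/
def KaplanskyClass (𝓕 : Set (ModuleCat.{u} R)) : Prop :=
  ∃ lam : Cardinal.{u}, ∀ M ∈ 𝓕, ∀ x : M, ∃ M' : Submodule R M,
    x ∈ M' ∧ Cardinal.mk M' ≤ lam ∧
    ModuleCat.of R M' ∈ 𝓕 ∧ ModuleCat.of R (M ⧸ M') ∈ 𝓕

end

section

open TensorProduct Limits

/-- A pair of composable linear maps `A → B → D`, used to test modules for exactness. -/
structure ExactnessTest (R : Type u) [CommRing R] where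
  A : ModuleCat.{u} R
  B : ModuleCat.{u} R
  D : ModuleCat.{u} R
  f : A →ₗ[R] B
  g : B →ₗ[R] D

namespace ExactnessTest

variable {R : Type u} [CommRing R] (t : ExactnessTest R)

/-- The kernel of `t.g ⊗ M` is contained in the range of `t.f ⊗ M`. -/
def Holds (M : Type u) [AddCommGroup M] [Module R M] : Prop :=
  ∀ x : t.B ⊗[R] M, t.g.rTensor M x = 0 → ∃ y, t.f.rTensor M y = x

variable {t} {M N : Type u} [AddCommGroup M] [Module R M] [AddCommGroup N] [Module R N]

lemma _root_.LinearMap.rTensor_lTensor_apply {A B : Type u} [AddCommGroup A] [Module R A]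
    [AddCommGroup B] [Module R B] (f : A →ₗ[R] B) (s : M →ₗ[R] N) (x : A ⊗[R] M) :
    f.rTensor N (s.lTensor A x) = s.lTensor B (f.rTensor M x) := by
  rw [← LinearMap.comp_apply, ← LinearMap.comp_apply, LinearMap.rTensor_comp_lTensor,
    LinearMap.lTensor_comp_rTensor]

lemma Holds.of_retract (h : t.Holds M) (s : N →ₗ[R] M) (r : M →ₗ[R] N)
    (hrs : r ∘ₗ s = LinearMap.id) : t.Holds N := by
  intro x hx
  obtain ⟨y, hy⟩ := h (s.lTensor _ x) (by rw [LinearMap.rTensor_lTensor_apply, hx, map_zero])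
  refine ⟨r.lTensor _ y, ?_⟩
  rw [LinearMap.rTensor_lTensor_apply, hy, ← LinearMap.comp_apply, ← LinearMap.lTensor_comp, hrs,
    LinearMap.lTensor_id, LinearMap.id_apply]

lemma Holds.congr (h : t.Holds M) (e : M ≃ₗ[R] N) : t.Holds N :=
  h.of_retract e.symm.toLinearMap e.toLinearMap (by ext; simp)

/-- Testing a quotient module. -/
lemma holds_of_exact_iff {K : Type u} [AddCommGroup K] [Module R K] {i : K →ₗ[R] M}
    {p : M →ₗ[R] N} (hip : Function.Exact i p) (hp : Function.Surjective p) :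
    t.Holds N ↔ ∀ x : t.B ⊗[R] M, t.g.rTensor M x ∈ LinearMap.range (i.lTensor t.D) →
      ∃ y m, x = t.f.rTensor M y + i.lTensor t.B m := by
  have ex (Q : ModuleCat.{u} R) : Function.Exact (i.lTensor Q) (p.lTensor Q) :=
    lTensor_exact Q hip hp
  have su (Q : ModuleCat.{u} R) : Function.Surjective (p.lTensor Q) :=
    LinearMap.lTensor_surjective Q hp
  constructor
  · intro h x hx
    obtain ⟨y, hy⟩ := h (p.lTensor _ x) (by
      rw [LinearMap.rTensor_lTensor_apply]; exact (ex _ _).2 hx)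
    obtain ⟨y, rfl⟩ := su _ y
    rw [LinearMap.rTensor_lTensor_apply, eq_comm, ← sub_eq_zero, ← map_sub] at hy
    obtain ⟨m, hm⟩ := (ex _ _).1 hy
    exact ⟨y, m, by rw [hm]; abel⟩
  · intro h x hx
    obtain ⟨x, rfl⟩ := su _ x
    rw [LinearMap.rTensor_lTensor_apply] at hx
    obtain ⟨y, m, rfl⟩ := h x ((ex _ _).1 hx)
    refine ⟨p.lTensor _ y, ?_⟩
    rw [LinearMap.rTensor_lTensor_apply, map_add, (ex _).apply_apply_eq_zero, add_zero]

lemma Holds.holds_of_lTensor_injective (h : t.Holds M) (s : N →ₗ[R] M)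
    (hs : Function.Injective (s.lTensor (t.B ⧸ LinearMap.range t.f))) : t.Holds N := by
  intro x hx
  obtain ⟨y, hy⟩ := h (s.lTensor _ x) (by rw [LinearMap.rTensor_lTensor_apply, hx, map_zero])
  have ex (M : Type u) [AddCommGroup M] [Module R M] :=
    rTensor_exact M (LinearMap.exact_map_mkQ_range t.f)
      (Submodule.mkQ_surjective (LinearMap.range t.f))
  refine (ex N x).1 (hs ?_)
  rw [map_zero, ← LinearMap.rTensor_lTensor_apply, ← hy, (ex M).apply_apply_eq_zero]

lemma Holds.holds_quotient_of_lTensor_injective (h : t.Holds M) (s : N →ₗ[R] M)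
    (hs : Function.Injective (s.lTensor (t.D ⧸ LinearMap.range t.g))) :
    t.Holds (M ⧸ LinearMap.range s) := by
  rw [holds_of_exact_iff (LinearMap.exact_map_mkQ_range s) (Submodule.mkQ_surjective _)]
  rintro x ⟨c, hc⟩
  have ex (M : Type u) [AddCommGroup M] [Module R M] :=
    rTensor_exact M (LinearMap.exact_map_mkQ_range t.g)
      (Submodule.mkQ_surjective (LinearMap.range t.g))
  obtain ⟨b, rfl⟩ := (ex N c).1 (hs (by
    rw [map_zero, ← LinearMap.rTensor_lTensor_apply, hc, (ex M).apply_apply_eq_zero]))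
  obtain ⟨y, hy⟩ := h (x - s.lTensor _ b) (by
    rw [map_sub, ← hc, LinearMap.rTensor_lTensor_apply, sub_self])
  exact ⟨y, b, by rw [hy]; abel⟩

lemma Holds.directSum {ι : Type u} {X : ι → Type u} [∀ i, AddCommGroup (X i)]
    [∀ i, Module R (X i)] (h : ∀ i, t.Holds (X i)) : t.Holds (DirectSum ι X) := by
  classical
  have key (x : t.B ⊗[R] DirectSum ι X) : ∃ s : Finset ι, x = ∑ i ∈ s,
      (DirectSum.lof R ι X i).lTensor _ ((DirectSum.component R ι X i).lTensor _ x) := by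
    suffices ∃ s : Finset ι, ∀ s', s ⊆ s' → x = ∑ i ∈ s',
        (DirectSum.lof R ι X i).lTensor _ ((DirectSum.component R ι X i).lTensor _ x) by
      obtain ⟨s, hs⟩ := this
      exact ⟨s, hs s subset_rfl⟩
    induction x with
    | zero => exact ⟨∅, by simp⟩
    | add x y hx hy =>
      obtain ⟨s, hs⟩ := hx
      obtain ⟨s', hs'⟩ := hy
      refine ⟨s ∪ s', fun r hr ↦ ?_⟩
      simp only [map_add, Finset.sum_add_distrib]
      rw [← hs r (Finset.union_subset_left hr), ← hs' r (Finset.union_subset_right hr)]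
    | tmul b m =>
      refine ⟨DFinsupp.support m, fun r hr ↦ ?_⟩
      simp only [LinearMap.lTensor_tmul, ← TensorProduct.tmul_sum]
      congr 1
      ext i
      simp only [DirectSum.sum_apply, DirectSum.lof_eq_of, DirectSum.of_apply]
      by_cases hi : i ∈ r
      · rw [Finset.sum_eq_single_of_mem i hi]
        · simp [DirectSum.component]; rfl
        · intro j _ hj
          simp [hj]
      · rw [Finset.sum_eq_zero]
        · by_contra h0
          exact hi (hr (by simpa using h0))
        · intro j hj
          have : j ≠ i := by rintro rfl; exact hi hj
          simp [this]
  intro x hx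
  obtain ⟨s, hs⟩ := key x
  choose y hy using fun i ↦ h i ((DirectSum.component R ι X i).lTensor _ x) (by
    rw [LinearMap.rTensor_lTensor_apply, hx, map_zero])
  refine ⟨∑ i ∈ s, (DirectSum.lof R ι X i).lTensor _ (y i), ?_⟩
  rw [map_sum, hs]
  refine Finset.sum_congr rfl fun i _ ↦ ?_
  rw [LinearMap.rTensor_lTensor_apply, hy]

end ExactnessTest

section Purification

variable {R : Type u} [CommRing R]

open Classical in
/-- The linear map `(M →₀ R) → N` sending the basis vector of `m` to `m` if `m ∈ N` and to zero
otherwise. -/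
noncomputable def Submodule.partialCombination {M : Type u} [AddCommGroup M] [Module R M]
    (N : Submodule R M) : (M →₀ R) →ₗ[R] N :=
  Finsupp.linearCombination R fun m ↦ if hm : m ∈ N then ⟨m, hm⟩ else 0

lemma Submodule.coe_partialCombination {M : Type u} [AddCommGroup M] [Module R M]
    (N : Submodule R M) (q : M →₀ R) (hq : ∀ m ∈ q.support, m ∈ N) :
    (N.partialCombination q : M) = Finsupp.linearCombination R id q := by
  rw [partialCombination, Finsupp.linearCombination_apply, Finsupp.linearCombination_apply,
    Finsupp.sum, Finsupp.sum, Submodule.coe_sum]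
  refine Finset.sum_congr rfl fun m hm ↦ ?_
  rw [dif_pos (hq m hm)]
  rfl

lemma exists_finset_tensor_vanishing (P : Type u) [AddCommGroup P] [Module R P]
    {Q M : Type u} [AddCommGroup Q] [Module R Q] [AddCommGroup M] [Module R M]
    (h : Q →ₗ[R] M) {K : Type u} [AddCommGroup K] [Module R K] (a : K →ₗ[R] Q)
    (b : K →ₗ[R] (M →₀ R)) (hab : ∀ k, h (a k) + Finsupp.linearCombination R id (b k) = 0)
    (w : P ⊗[R] K) :
    ∃ s : Finset M, ∀ (N : Submodule R M) (hN : ∀ q, h q ∈ N), (∀ m ∈ s, m ∈ N) →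
      (h.codRestrict N hN ∘ₗ a + N.partialCombination ∘ₗ b).lTensor P w = 0 := by
  classical
  induction w with
  | zero => exact ⟨∅, fun N hN _ ↦ map_zero _⟩
  | add a b ha hb =>
    obtain ⟨s, hs⟩ := ha
    obtain ⟨s', hs'⟩ := hb
    refine ⟨s ∪ s', fun N hN hr ↦ ?_⟩
    rw [map_add, hs N hN fun m hm ↦ hr m (Finset.mem_union_left _ hm),
      hs' N hN fun m hm ↦ hr m (Finset.mem_union_right _ hm), add_zero]
  | tmul p k =>
    refine ⟨(b k).support, fun N hN hr ↦ ?_⟩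
    have : (h.codRestrict N hN ∘ₗ a + N.partialCombination ∘ₗ b) k = 0 := by
      refine Subtype.ext ?_
      rw [LinearMap.add_apply, Submodule.coe_add, LinearMap.comp_apply, LinearMap.comp_apply,
        N.coe_partialCombination _ hr]
      exact hab k
    rw [LinearMap.lTensor_tmul, this, TensorProduct.tmul_zero]

lemma lTensor_subtype_ker_exact (P : Type u) [AddCommGroup P] [Module R P]
    {X M : Type u} [AddCommGroup X] [Module R X] [AddCommGroup M] [Module R M]
    (Θ : X →ₗ[R] M) (hΘ : Function.Surjective Θ) :
    Function.Exact ((LinearMap.ker Θ).subtype.lTensor P) (Θ.lTensor P) :=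
  lTensor_exact P Θ.exact_subtype_ker_map hΘ

/-- If an element of `P ⊗ Q` vanishes in `P ⊗ M`, it already vanishes in `P ⊗ N` as soon as `N`
contains the image of `Q` and countably many suitable elements. -/
lemma exists_nat_tensor_vanishing (P : Type u) [AddCommGroup P] [Module R P]
    {Q M : Type u} [AddCommGroup Q] [Module R Q] [AddCommGroup M] [Module R M]
    (h : Q →ₗ[R] M) (z : P ⊗[R] Q) (hz : h.lTensor P z = 0) :
    ∃ e : ℕ → M, ∀ (N : Submodule R M) (hN : ∀ q, h q ∈ N), (∀ k, e k ∈ N) →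
      (h.codRestrict N hN).lTensor P z = 0 := by
  obtain ⟨Θ, hΘ⟩ : ∃ Θ, Θ = h.coprod (Finsupp.linearCombination R (id : M → M)) := ⟨_, rfl⟩
  have hΘ' : Function.Surjective Θ := fun m ↦ ⟨(0, Finsupp.single m 1), by simp [hΘ]⟩
  obtain ⟨w, hw⟩ := (lTensor_subtype_ker_exact P Θ hΘ'
    ((LinearMap.inl R Q (M →₀ R)).lTensor P z)).1 (by
    rw [← LinearMap.comp_apply, ← LinearMap.lTensor_comp, hΘ, LinearMap.coprod_inl, hz])
  obtain ⟨s, hs⟩ := exists_finset_tensor_vanishing P h (K := LinearMap.ker Θ)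
    (LinearMap.fst R Q (M →₀ R) ∘ₗ (LinearMap.ker Θ).subtype)
    (LinearMap.snd R Q (M →₀ R) ∘ₗ (LinearMap.ker Θ).subtype)
    (fun k ↦ by
      have := k.2
      rwa [LinearMap.mem_ker, congrArg (· k.1) (congrArg DFunLike.coe hΘ)] at this) w
  obtain ⟨e, he⟩ : ∃ e : ℕ → M, insert (0 : M) (s : Set M) = Set.range e :=
    (s.countable_toSet.insert 0).exists_eq_range (Set.insert_nonempty _ _)
  refine ⟨e, fun N hN hk ↦ ?_⟩
  have hsN (m : M) (hm : m ∈ s) : m ∈ N := by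
    obtain ⟨k, rfl⟩ := he.subset (Set.mem_insert_of_mem 0 hm)
    exact hk k
  have := hs N hN hsN
  rw [← LinearMap.comp_assoc, ← LinearMap.comp_assoc, ← LinearMap.add_comp,
    LinearMap.lTensor_comp, LinearMap.comp_apply, hw, ← LinearMap.comp_apply,
    ← LinearMap.lTensor_comp, LinearMap.add_comp, LinearMap.comp_assoc, LinearMap.comp_assoc,
    LinearMap.fst_comp_inl, LinearMap.snd_comp_inl, LinearMap.comp_id, LinearMap.comp_zero,
    add_zero] at this
  exact this

/-- The generators needed to kill the kernel of `P i ⊗ (S →₀ R) → P i ⊗ M`. -/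
def PurificationStep {ι : Type} (P : ι → ModuleCat.{u} R) (S : Type u) : Type u :=
  S ⊕ ((Σ i, P i ⊗[R] (S →₀ R)) × ℕ)

lemma exists_purificationStep {ι : Type} (P : ι → ModuleCat.{u} R) {S : Type u}
    {M : Type u} [AddCommGroup M] [Module R M] (h : S → M) :
    ∃ h' : PurificationStep P S → M, (∀ s, h' (Sum.inl s) = h s) ∧
      ∀ (N : Submodule R M) (_ : ∀ s, h' s ∈ N)
        (hN : ∀ q, Finsupp.linearCombination R h q ∈ N)
        (i : ι) (z : P i ⊗[R] (S →₀ R)),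
        (Finsupp.linearCombination R h).lTensor (P i) z = 0 →
        ((Finsupp.linearCombination R h).codRestrict N hN).lTensor (P i) z = 0 := by
  classical
  choose! e he using fun (i : ι) (z : P i ⊗[R] (S →₀ R)) ↦
    exists_nat_tensor_vanishing (P i) (Finsupp.linearCombination R h) z
  refine ⟨Sum.elim h fun x ↦ e x.1.1 x.1.2 x.2, fun _ ↦ rfl, fun N hN hN' i z hz ↦ ?_⟩
  exact he i z hz N hN' fun k ↦ hN (Sum.inr (⟨i, z⟩, k))

/-- The index type of the generators obtained by iterating `PurificationStep`. -/
def PurificationIndex {ι : Type} (P : ι → ModuleCat.{u} R) : ℕ → Type u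
  | 0 => PUnit
  | n + 1 => PurificationStep P (PurificationIndex P n)

/-- Generators obtained by iterating a choice of new generators, starting with one element. -/
def purificationGenerators {ι : Type} (P : ι → ModuleCat.{u} R) {M : Type u}
    (F : ∀ S : Type u, (S → M) → PurificationStep P S → M) (x : M) :
    ∀ n, PurificationIndex P n → M
  | 0 => fun _ ↦ x
  | n + 1 => F _ (purificationGenerators P F x n)

/-- Given a family of modules `P`, every element of a module is contained in a submodule with a
bounded number of generators which stays a submodule after tensoring with the `P i`. -/
theorem exists_bounded_lTensor_injective {ι : Type} (P : ι → ModuleCat.{u} R) :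
    ∃ S : Type u, ∀ (M : Type u) [AddCommGroup M] [Module R M] (x : M),
      ∃ h : (S →₀ R) →ₗ[R] M, x ∈ LinearMap.range h ∧
        ∀ i, Function.Injective ((LinearMap.range h).subtype.lTensor (P i)) := by
  let T := PurificationIndex P
  refine ⟨Σ n, T n, fun M _ _ x ↦ ?_⟩
  choose F hF₁ hF₂ using fun (S : Type u) (h : S → M) ↦ exists_purificationStep P h
  let h : ∀ n, T n → M := purificationGenerators P F x
  let H : ((Σ n, T n) →₀ R) →ₗ[R] M := Finsupp.linearCombination R fun s ↦ h s.1 s.2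
  have hmem (n) (s : T n) : h n s ∈ LinearMap.range H := ⟨Finsupp.single ⟨n, s⟩ 1, by simp [H]⟩
  have hmem' (n) (q) : Finsupp.linearCombination R (h n) q ∈ LinearMap.range H := by
    rw [Finsupp.linearCombination_apply]
    exact Submodule.sum_mem _ fun s _ ↦ Submodule.smul_mem _ _ (hmem n s)
  refine ⟨H, hmem 0 PUnit.unit, fun i ↦ ?_⟩
  let r (n) := LinearMap.range (Finsupp.linearCombination R (h n))
  have r_mono : Monotone r := by
    refine monotone_nat_of_le_succ fun n ↦ ?_
    rintro _ ⟨q, rfl⟩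
    rw [Finsupp.linearCombination_apply]
    refine Submodule.sum_mem _ fun s _ ↦ Submodule.smul_mem _ _ ?_
    let s' : T (n + 1) := Sum.inl s
    refine ⟨Finsupp.single s' 1, ?_⟩
    rw [Finsupp.linearCombination_single, one_smul]
    exact hF₁ (T n) (h n) s
  have hr (m : LinearMap.range H) : ∃ n, (m : M) ∈ r n := by
    obtain ⟨_, q, rfl⟩ := m
    induction q using Finsupp.induction_linear with
    | zero => exact ⟨0, by simp⟩
    | add a b ha hb =>
      obtain ⟨n, hn⟩ := ha
      obtain ⟨k, hk⟩ := hb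
      refine ⟨max n k, ?_⟩
      simp only [map_add] at *
      exact add_mem (r_mono (le_max_left n k) hn) (r_mono (le_max_right n k) hk)
    | single s a =>
      exact ⟨s.1, Finsupp.single s.2 a, by simp [H]⟩
  let c (n) := (Finsupp.linearCombination R (h n)).codRestrict _ (hmem' n)
  have hw (w : P i ⊗[R] LinearMap.range H) : ∃ n, ∀ k ≥ n, ∃ z, (c k).lTensor (P i) z = w := by
    induction w with
    | zero => exact ⟨0, fun k _ ↦ ⟨0, map_zero _⟩⟩
    | tmul p m =>
      obtain ⟨n, hn⟩ := hr m
      refine ⟨n, fun k hk ↦ ?_⟩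
      obtain ⟨q, hq⟩ := r_mono hk hn
      exact ⟨p ⊗ₜ q, by
        rw [LinearMap.lTensor_tmul]; congr 1; exact Subtype.ext hq⟩
    | add a b ha hb =>
      obtain ⟨n, hn⟩ := ha
      obtain ⟨k, hk⟩ := hb
      refine ⟨max n k, fun l hl ↦ ?_⟩
      obtain ⟨z, rfl⟩ := hn l (le_trans (le_max_left _ _) hl)
      obtain ⟨z', rfl⟩ := hk l (le_trans (le_max_right _ _) hl)
      exact ⟨z + z', map_add _ _ _⟩
  rw [injective_iff_map_eq_zero]
  intro w hw0
  obtain ⟨n, hn⟩ := hw w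
  obtain ⟨z, rfl⟩ := hn n le_rfl
  refine hF₂ (T n) (h n) (LinearMap.range H) (hmem (n + 1)) (hmem' n) i z ?_
  rw [← hw0, ← LinearMap.comp_apply, ← LinearMap.lTensor_comp]
  rfl

end Purification

section Extension

variable {R : Type u} [CommRing R]

lemma LinearMap.exists_comp_eq_of_surjective {M N E : Type u} [AddCommGroup M] [Module R M]
    [AddCommGroup N] [Module R N] [AddCommGroup E] [Module R E] (p : M →ₗ[R] N)
    (hp : Function.Surjective p) (φ : M →ₗ[R] E) (h : ∀ m, p m = 0 → φ m = 0) :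
    ∃ g : N →ₗ[R] E, g ∘ₗ p = φ := by
  refine ⟨(LinearMap.ker p).liftQ φ (fun m hm ↦ h m hm) ∘ₗ
    (p.quotKerEquivOfSurjective hp).symm.toLinearMap, ?_⟩
  ext m
  have : (p.quotKerEquivOfSurjective hp).symm (p m) = (LinearMap.ker p).mkQ m := by
    rw [LinearEquiv.symm_apply_eq]
    rfl
  simp only [LinearMap.comp_apply, LinearEquiv.coe_coe, this]
  rfl

lemma LinearMap.exists_comp_eq_of_injective {M N E : Type u} [AddCommGroup M] [Module R M]
    [AddCommGroup N] [Module R N] [AddCommGroup E] [Module R E] (i : M →ₗ[R] N)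
    (hi : Function.Injective i) (φ : E →ₗ[R] N) (h : ∀ e, φ e ∈ LinearMap.range i) :
    ∃ g : E →ₗ[R] M, i ∘ₗ g = φ := by
  refine ⟨(LinearEquiv.ofInjective i hi).symm.toLinearMap ∘ₗ φ.codRestrict _ h, ?_⟩
  ext e
  have := (LinearEquiv.ofInjective i hi).apply_symm_apply (φ.codRestrict _ h e)
  exact congrArg Subtype.val this

variable (R) in
/-- For every short exact sequence `0 → A → B → X → 0`, linear maps `A → E` extend to `B`. -/
def HasExtensions (X E : Type u) [AddCommGroup X] [Module R X] [AddCommGroup E] [Module R E] :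
    Prop :=
  ∀ (A B : Type u) [AddCommGroup A] [Module R A] [AddCommGroup B] [Module R B]
    (i : A →ₗ[R] B) (p : B →ₗ[R] X), Function.Injective i → Function.Exact i p →
    Function.Surjective p → ∀ f : A →ₗ[R] E, ∃ g : B →ₗ[R] E, g ∘ₗ i = f

variable {X E : Type u} [AddCommGroup X] [Module R X] [AddCommGroup E] [Module R E]

lemma HasExtensions.of_projective {P : Type u} [AddCommGroup P] [Module R P]
    [Module.Projective R P] (q : P →ₗ[R] X) (hq : Function.Surjective q)
    (h : ∀ f : LinearMap.ker q →ₗ[R] E, ∃ g : P →ₗ[R] E, g ∘ₗ (LinearMap.ker q).subtype = f) :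
    HasExtensions R X E := by
  intro A B _ _ _ _ i p hi hip hp f
  obtain ⟨l, hl⟩ := Module.projective_lifting_property p q hp
  obtain ⟨k, hk⟩ := LinearMap.exists_comp_eq_of_injective i hi
    (l ∘ₗ (LinearMap.ker q).subtype) fun x ↦ (hip _).1 ((LinearMap.congr_fun hl x.1).trans x.2)
  obtain ⟨g₀, hg₀⟩ := h (f ∘ₗ k)
  have hsurj : Function.Surjective (i.coprod l) := by
    intro b
    obtain ⟨x, hx⟩ := hq (p b)
    obtain ⟨a, ha⟩ := (hip (b - l x)).1 (by
      rw [map_sub, ← LinearMap.comp_apply, hl, hx, sub_self])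
    exact ⟨(a, x), by rw [LinearMap.coprod_apply, ha, sub_add_cancel]⟩
  obtain ⟨g, hg⟩ := LinearMap.exists_comp_eq_of_surjective (i.coprod l) hsurj (f.coprod g₀) (by
    rintro ⟨a, x⟩ hax
    rw [LinearMap.coprod_apply] at hax ⊢
    have hx : q x = 0 := by
      rw [← hl, LinearMap.comp_apply, eq_neg_of_add_eq_zero_right hax, map_neg,
        hip.apply_apply_eq_zero, neg_zero]
    have hk' : k ⟨x, hx⟩ = -a := hi (by
      rw [map_neg, ← eq_neg_of_add_eq_zero_right hax]
      exact LinearMap.congr_fun hk ⟨x, hx⟩)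
    have : g₀ x = f (k ⟨x, hx⟩) := LinearMap.congr_fun hg₀ ⟨x, hx⟩
    rw [this, hk', map_neg, add_neg_cancel])
  refine ⟨g, ?_⟩
  rw [← LinearMap.coprod_inl i l, ← LinearMap.comp_assoc, hg, LinearMap.coprod_inl]

lemma HasExtensions.of_retract (h : HasExtensions R X E) {E' : Type u} [AddCommGroup E']
    [Module R E'] (s : E' →ₗ[R] E) (r : E →ₗ[R] E') (hrs : r ∘ₗ s = LinearMap.id) :
    HasExtensions R X E' := by
  intro A B _ _ _ _ i p hi hip hp f
  obtain ⟨g, hg⟩ := h A B i p hi hip hp (s ∘ₗ f)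
  exact ⟨r ∘ₗ g, by rw [LinearMap.comp_assoc, hg, ← LinearMap.comp_assoc, hrs, LinearMap.id_comp]⟩

lemma HasExtensions.exists_lift (h : HasExtensions R X E) {F N : Type u} [AddCommGroup F]
    [Module R F] [AddCommGroup N] [Module R N] (i : E →ₗ[R] F) (p : F →ₗ[R] N)
    (hi : Function.Injective i) (hip : Function.Exact i p) (hp : Function.Surjective p)
    (φ : X →ₗ[R] N) : ∃ ψ : X →ₗ[R] F, p ∘ₗ ψ = φ := by
  let K : Submodule R (F × X) :=
    LinearMap.eqLocus (p ∘ₗ LinearMap.fst R F X) (φ ∘ₗ LinearMap.snd R F X)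
  have hK (k : K) : p k.1.1 = φ k.1.2 := k.2
  let a : E →ₗ[R] K := (LinearMap.inl R F X ∘ₗ i).codRestrict K fun e ↦ by
    simp [K, hip.apply_apply_eq_zero]
  let π : K →ₗ[R] X := LinearMap.snd R F X ∘ₗ K.subtype
  have hπ : Function.Surjective π := fun x ↦ by
    obtain ⟨y, hy⟩ := hp (φ x)
    exact ⟨⟨(y, x), hy⟩, rfl⟩
  have ha (e : E) : (a e : F × X) = (i e, 0) := rfl
  have hex (k : K) (hk : π k = 0) : ∃ e, a e = k := by
    have h0 : k.1.2 = 0 := hk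
    obtain ⟨e, he⟩ := (hip k.1.1).1 (by rw [hK, h0, map_zero])
    exact ⟨e, Subtype.ext (Prod.ext he h0.symm)⟩
  obtain ⟨ρ, hρ⟩ := h E K a π
    (fun e e' hee ↦ hi (congrArg (fun k : K ↦ k.1.1) hee))
    (fun k ↦ ⟨hex k, by rintro ⟨e, rfl⟩; rfl⟩) hπ LinearMap.id
  obtain ⟨ψ, hψ⟩ := LinearMap.exists_comp_eq_of_surjective π hπ
    (LinearMap.fst R F X ∘ₗ K.subtype - i ∘ₗ ρ) (by
      intro k hk
      obtain ⟨e, rfl⟩ := hex k hk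
      have : ρ (a e) = e := LinearMap.congr_fun hρ e
      simp only [LinearMap.sub_apply, LinearMap.comp_apply, this]
      exact sub_self _)
  refine ⟨ψ, ?_⟩
  ext x
  obtain ⟨k, rfl⟩ := hπ x
  rw [LinearMap.comp_apply, ← LinearMap.comp_apply ψ, hψ, LinearMap.sub_apply, map_sub,
    LinearMap.comp_apply, LinearMap.comp_apply, hip.apply_apply_eq_zero, sub_zero]
  exact hK k

end Extension

section TestClass

variable {R : Type u} [CommRing R] {ι : Type} (t : ι → ExactnessTest R)

/-- The module `M` passes all tests of a family. -/
def PassesTests (M : Type u) [AddCommGroup M] [Module R M] : Prop := ∀ i, (t i).Holds M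

variable {t}

lemma PassesTests.congr {M N : Type u} [AddCommGroup M] [Module R M] [AddCommGroup N] [Module R N]
    (h : PassesTests t M) (e : M ≃ₗ[R] N) : PassesTests t N := fun i ↦ (h i).congr e

lemma PassesTests.of_retract {M N : Type u} [AddCommGroup M] [Module R M] [AddCommGroup N]
    [Module R N] (h : PassesTests t M) (s : N →ₗ[R] M) (r : M →ₗ[R] N)
    (hrs : r ∘ₗ s = LinearMap.id) : PassesTests t N := fun i ↦ (h i).of_retract s r hrs

lemma PassesTests.directSum {κ : Type u} {X : κ → Type u} [∀ i, AddCommGroup (X i)]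
    [∀ i, Module R (X i)] (h : ∀ i, PassesTests t (X i)) : PassesTests t (DirectSum κ X) :=
  fun i ↦ .directSum fun j ↦ h j i

lemma PassesTests.finsupp (hR : PassesTests t R) (S : Type u) : PassesTests t (S →₀ R) := by
  classical
  exact (PassesTests.directSum (X := fun _ : S ↦ R) fun _ ↦ hR).congr
    (finsuppLEquivDirectSum R R S).symm

lemma PassesTests.of_projective (hR : PassesTests t R) (P : Type u) [AddCommGroup P] [Module R P]
    [Module.Projective R P] : PassesTests t P := by
  obtain ⟨s, hs⟩ := (Module.projective_def' (R := R) (P := P)).1 inferInstance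
  exact (PassesTests.finsupp hR P).of_retract s _ hs

variable (t) in
/-- Modules passing a family of tests contain, around each element, a submodule with a bounded
number of generators such that both the submodule and the quotient pass the tests. -/
theorem exists_bounded_passesTests : ∃ S : Type u, ∀ (M : Type u) [AddCommGroup M] [Module R M],
    PassesTests t M → ∀ x : M, ∃ h : (S →₀ R) →ₗ[R] M, x ∈ LinearMap.range h ∧
      PassesTests t (LinearMap.range h) ∧ PassesTests t (M ⧸ LinearMap.range h) := by
  obtain ⟨S, hS⟩ := exists_bounded_lTensor_injective (R := R) (ι := ι ⊕ ι)
    (Sum.elim (fun i ↦ ModuleCat.of R ((t i).B ⧸ LinearMap.range (t i).f))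
      fun i ↦ ModuleCat.of R ((t i).D ⧸ LinearMap.range (t i).g))
  refine ⟨S, fun M _ _ hM x ↦ ?_⟩
  obtain ⟨h, hx, hh⟩ := hS M x
  refine ⟨h, hx, fun i ↦ (hM i).holds_of_lTensor_injective _ (hh (Sum.inl i)), fun i ↦ ?_⟩
  have := (hM i).holds_quotient_of_lTensor_injective _ (hh (Sum.inr i))
  rwa [Submodule.range_subtype] at this

end TestClass

section Transfinite

variable {R : Type u} [CommRing R]

lemma Submodule.exists_mem_lTensor_of_sSup {M : Type u} [AddCommGroup M] [Module R M]
    (c : Set (Submodule R M)) (hc : DirectedOn (· ≤ ·) c) (hne : c.Nonempty) {U : Submodule R M}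
    (hU : U = sSup c) (Q : Type u) [AddCommGroup Q] [Module R Q] (x : Q ⊗[R] U) :
    ∃ V ∈ c, U.subtype.lTensor Q x ∈ LinearMap.range (V.subtype.lTensor Q) := by
  induction x with
  | zero =>
    obtain ⟨V, hV⟩ := hne
    exact ⟨V, hV, by rw [map_zero]; exact zero_mem _⟩
  | tmul q m =>
    obtain ⟨V, hV, hm⟩ := (Submodule.mem_sSup_of_directed hne hc).1 (by rw [← hU]; exact m.2)
    exact ⟨V, hV, q ⊗ₜ ⟨m, hm⟩, rfl⟩
  | add a b ha hb =>
    obtain ⟨V, hV, a', ha⟩ := ha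
    obtain ⟨W, hW, b', hb⟩ := hb
    obtain ⟨Z, hZ, hVZ, hWZ⟩ := hc V hV W hW
    refine ⟨Z, hZ, (Submodule.inclusion hVZ).lTensor Q a' + (Submodule.inclusion hWZ).lTensor Q b',
      ?_⟩
    rw [map_add, map_add, ← ha, ← hb, ← LinearMap.comp_apply, ← LinearMap.comp_apply,
      ← LinearMap.lTensor_comp, ← LinearMap.lTensor_comp]
    rfl

lemma ExactnessTest.Holds.quotient_sSup {t : ExactnessTest R} {M : Type u} [AddCommGroup M]
    [Module R M] (c : Set (Submodule R M)) (hc : DirectedOn (· ≤ ·) c) (hne : c.Nonempty)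
    {U : Submodule R M} (hU : U = sSup c) (h : ∀ V ∈ c, t.Holds (M ⧸ V)) : t.Holds (M ⧸ U) := by
  rw [holds_of_exact_iff (LinearMap.exact_subtype_mkQ U) U.mkQ_surjective]
  rintro x ⟨d, hd⟩
  obtain ⟨V, hV, v, hv⟩ := Submodule.exists_mem_lTensor_of_sSup c hc hne hU t.D d
  have hVU : V ≤ U := hU ▸ le_sSup hV
  obtain ⟨y, m, rfl⟩ := (holds_of_exact_iff (LinearMap.exact_subtype_mkQ V) V.mkQ_surjective).1
    (h V hV) x ⟨v, hv.trans hd⟩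
  refine ⟨y, (Submodule.inclusion hVU).lTensor _ m, ?_⟩
  rw [← LinearMap.comp_apply _ (LinearMap.lTensor _ _), ← LinearMap.lTensor_comp]
  rfl

variable {ι : Type} {t : ι → ExactnessTest R}

lemma LinearPMap.exists_lt_of_passesTests {S : Type u} (hS : ∀ (M : Type u) [AddCommGroup M]
      [Module R M], PassesTests t M → ∀ x : M, ∃ h : (S →₀ R) →ₗ[R] M, x ∈ LinearMap.range h ∧
      PassesTests t (LinearMap.range h) ∧ PassesTests t (M ⧸ LinearMap.range h))
    {E : Type u} [AddCommGroup E] [Module R E]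
    (hE : ∀ L : Submodule R (S →₀ R), PassesTests t ((S →₀ R) ⧸ L) → ∀ f : L →ₗ[R] E,
      ∃ g : (S →₀ R) →ₗ[R] E, g ∘ₗ L.subtype = f)
    {B : Type u} [AddCommGroup B] [Module R B] (q : B →ₗ.[R] E)
    (hq : PassesTests t (B ⧸ q.domain)) (x : B) :
    ∃ q' : B →ₗ.[R] E, q ≤ q' ∧ x ∈ q'.domain ∧ PassesTests t (B ⧸ q'.domain) := by
  obtain ⟨h, hx, h₁, h₂⟩ := hS _ hq (q.domain.mkQ x)
  let M' := LinearMap.range h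
  let V : Submodule R B := M'.comap q.domain.mkQ
  have hV : q.domain ≤ V := fun b hb ↦ by
    rw [Submodule.mem_comap, Submodule.mkQ_apply, (Submodule.Quotient.mk_eq_zero _).2 hb]
    exact zero_mem _
  have ext : HasExtensions R M' E := by
    refine .of_projective h.rangeRestrict h.surjective_rangeRestrict fun f ↦ hE _ ?_ f
    exact h₁.congr (h.rangeRestrict.quotKerEquivOfSurjective h.surjective_rangeRestrict).symm
  let p : V →ₗ[R] M' := q.domain.mkQ.restrict fun b hb ↦ hb
  have hp : Function.Surjective p := by
    rintro ⟨m, hm⟩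
    obtain ⟨b, rfl⟩ := q.domain.mkQ_surjective m
    exact ⟨⟨b, hm⟩, rfl⟩
  have hex : Function.Exact (Submodule.inclusion hV) p := by
    intro b
    constructor
    · intro hb
      have hb' : q.domain.mkQ b = 0 := congrArg Subtype.val hb
      exact ⟨⟨b, (Submodule.Quotient.mk_eq_zero _).1 hb'⟩, rfl⟩
    · rintro ⟨b, rfl⟩
      exact Subtype.ext ((Submodule.Quotient.mk_eq_zero _).2 b.2)
  obtain ⟨g, hg⟩ := ext _ _ _ p (Submodule.inclusion_injective hV) hex hp q.toFun
  refine ⟨⟨V, g⟩, ⟨hV, ?_⟩, hx, ?_⟩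
  · rintro b ⟨b', hb'⟩ (hbb : (b : B) = b')
    have : (⟨b', hb'⟩ : V) = Submodule.inclusion hV b := Subtype.ext hbb.symm
    change q.toFun b = g ⟨b', hb'⟩
    rw [this, ← hg]
    rfl
  · have hk : LinearMap.ker (M'.mkQ ∘ₗ q.domain.mkQ) = V := by
      rw [LinearMap.ker_comp, Submodule.ker_mkQ]
    refine h₂.congr ?_
    exact (((M'.mkQ ∘ₗ q.domain.mkQ).quotKerEquivOfSurjective
      (M'.mkQ_surjective.comp q.domain.mkQ_surjective)).symm.trans
        (Submodule.quotEquivOfEq _ _ hk))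

/-- To extend linear maps along inclusions with quotient passing the tests, it suffices to
consider submodules of a single free module. -/
theorem HasExtensions.of_bounded {S : Type u} (hS : ∀ (M : Type u) [AddCommGroup M]
      [Module R M], PassesTests t M → ∀ x : M, ∃ h : (S →₀ R) →ₗ[R] M, x ∈ LinearMap.range h ∧
      PassesTests t (LinearMap.range h) ∧ PassesTests t (M ⧸ LinearMap.range h))
    {E : Type u} [AddCommGroup E] [Module R E]
    (hE : ∀ L : Submodule R (S →₀ R), PassesTests t ((S →₀ R) ⧸ L) → ∀ f : L →ₗ[R] E,
      ∃ g : (S →₀ R) →ₗ[R] E, g ∘ₗ L.subtype = f)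
    {X : Type u} [AddCommGroup X] [Module R X] (hX : PassesTests t X) : HasExtensions R X E := by
  intro A B _ _ _ _ i p hi hip hp f
  let e := LinearEquiv.ofInjective i hi
  let q₀ : B →ₗ.[R] E := ⟨LinearMap.range i, f ∘ₗ e.symm.toLinearMap⟩
  let 𝒮 : Set (B →ₗ.[R] E) := {q | PassesTests t (B ⧸ q.domain)}
  have hq₀ : q₀ ∈ 𝒮 := by
    have hk : LinearMap.ker p = LinearMap.range i := hip.linearMap_ker_eq
    exact hX.congr ((p.quotKerEquivOfSurjective hp).symm.trans (Submodule.quotEquivOfEq _ _ hk))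
  obtain ⟨q, hq₀q, hq⟩ := zorn_le_nonempty₀ 𝒮 (fun c hc hchain y hy ↦ by
    have hdir : DirectedOn (· ≤ ·) c := hchain.directedOn
    refine ⟨LinearPMap.sSup c hdir, fun j ↦ ?_, fun z hz ↦ LinearPMap.le_sSup hdir hz⟩
    refine ExactnessTest.Holds.quotient_sSup (LinearPMap.domain '' c) ?_ ⟨_, y, hy, rfl⟩
      (LinearPMap.domain_sSup hdir) ?_
    · rintro _ ⟨a, ha, rfl⟩ _ ⟨b, hb, rfl⟩
      obtain ⟨z, hz, haz, hbz⟩ := hdir a ha b hb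
      exact ⟨_, ⟨z, hz, rfl⟩, haz.1, hbz.1⟩
    · rintro _ ⟨a, ha, rfl⟩
      exact hc ha j) q₀ hq₀
  have htop (b : B) : b ∈ q.domain := by
    obtain ⟨q', hqq', hb, hq'⟩ := q.exists_lt_of_passesTests hS hE hq.1 b
    exact (hq.2 hq' hqq').1 hb
  refine ⟨q.toFun ∘ₗ LinearMap.id.codRestrict q.domain htop, ?_⟩
  ext a
  have := hq₀q.2 (x := e a) (y := ⟨i a, htop _⟩) rfl
  refine Eq.trans this.symm ?_
  change f (e.symm (e a)) = f a
  rw [e.symm_apply_apply]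

end Transfinite

section IterationChain

universe v w

variable {R : Type u} [CommRing R] {𝒦 : Type w} [Category.{v} 𝒦]

/-- A transfinite chain indexed by `J`, obtained by iterating `σ`, together with a colimit,
described in terms of the elements of the modules assigned to the objects by `U`. -/
structure IterationChain (U : 𝒦 ⥤ ModuleCat.{u} R) {s : 𝒦 → 𝒦} (σ : ∀ X, X ⟶ s X)
    (J : Type u) [LinearOrder J] [SuccOrder J] where
  F : J ⥤ 𝒦
  B : 𝒦
  a : ∀ j, F.obj j ⟶ B
  w : ∀ {i j} (h : i ⟶ j), F.map h ≫ a j = a i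
  exists_rep : ∀ b : U.obj B, ∃ j x, U.map (a j) x = b
  exists_eq : ∀ j (x y : U.obj (F.obj j)), U.map (a j) x = U.map (a j) y →
    ∃ k, ∃ h : j ⟶ k, U.map (F.map h) x = U.map (F.map h) y
  exists_rep_of_isSuccLimit : ∀ m, Order.IsSuccLimit m → ∀ x : U.obj (F.obj m),
    ∃ j, ∃ h : j < m, ∃ y, U.map (F.map (homOfLE h.le)) y = x
  exists_iso : ∀ j, ∃ e : F.obj (Order.succ j) ≅ s (F.obj j),
    F.map (homOfLE (Order.le_succ j)) ≫ e.hom = σ (F.obj j)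

variable [HasFilteredColimitsOfSize.{u, u} 𝒦] (U : 𝒦 ⥤ ModuleCat.{u} R)
  [PreservesFilteredColimitsOfSize.{u, u} U]

theorem exists_iterationChain {s : 𝒦 → 𝒦} (σ : ∀ X, X ⟶ s X) (X₀ : 𝒦) (κ : Cardinal.{u})
    (hκ : κ.IsRegular) :
    ∃ (J : Type u) (_ : LinearOrder J) (_ : SuccOrder J) (_ : WellFoundedLT J) (_ : NoMaxOrder J),
      Cardinal.mk J = κ ∧ (∀ (K : Type u) (f : K → J), Cardinal.mk K < κ → ∃ j, ∀ k, f k ≤ j) ∧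
      Nonempty (IterationChain U σ J) := by
  have : Fact κ.IsRegular := ⟨hκ⟩
  have : NoMaxOrder κ.ord.ToType := Cardinal.noMaxOrder hκ.aleph0_le
  have : Nonempty κ.ord.ToType := by simpa using hκ.ne_zero
  let _ : OrderBot κ.ord.ToType := WellFoundedLT.toOrderBot κ.ord.ToType
  let _ : SuccOrder κ.ord.ToType := SuccOrder.ofLinearWellFoundedLT _
  have hfilt (I : Type u) [SmallCategory I] [IsFiltered I] : HasColimitsOfShape I 𝒦 :=
    HasFilteredColimitsOfSize.HasColimitsOfShape I
  have hpres (I : Type u) [SmallCategory I] [IsFiltered I] : PreservesColimitsOfShape I U :=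
    PreservesFilteredColimitsOfSize.preserves_filtered_colimits I
  have hIio (j : κ.ord.ToType) (hj : Order.IsSuccLimit j) : Nonempty (Set.Iio j) :=
    ⟨⟨⊥, hj.bot_lt⟩⟩
  have : HasIterationOfShape κ.ord.ToType 𝒦 :=
    { hasColimitsOfShape_of_isSuccLimit := fun j hj ↦ by
        have := hIio j hj
        infer_instance
      hasColimitsOfShape := inferInstance }
  let Φ : SmallObject.SuccStruct 𝒦 := ⟨X₀, s, σ⟩
  refine ⟨κ.ord.ToType, inferInstance, inferInstance, inferInstance, inferInstance, by simp,
    fun K f hK ↦ ?_, ⟨?_⟩⟩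
  · exact ⟨IsCardinalFiltered.max (κ := κ) f (by rwa [hasCardinalLT_iff_cardinal_mk_lt]),
      fun k ↦ leOfHom (IsCardinalFiltered.toMax f _ k)⟩
  exact
    { F := Φ.iterationFunctor κ.ord.ToType
      B := Φ.iteration κ.ord.ToType
      a := (Φ.iterationCocone κ.ord.ToType).ι.app
      w := fun h ↦ (Φ.iterationCocone κ.ord.ToType).w h
      exists_rep := fun b ↦ Concrete.isColimit_exists_rep _
        (isColimitOfPreserves U (Φ.isColimitIterationCocone κ.ord.ToType)) b
      exists_eq := fun j x y hxy ↦ by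
        obtain ⟨k, f, g, h⟩ := Concrete.isColimit_exists_of_rep_eq _
          (isColimitOfPreserves U (Φ.isColimitIterationCocone κ.ord.ToType)) x y hxy
        exact ⟨k, f, h⟩
      exists_rep_of_isSuccLimit := fun m hm x ↦ by
        have := hIio m hm
        obtain ⟨j, y, h⟩ := Concrete.isColimit_exists_rep _ (isColimitOfPreserves U
          ((Φ.iterationFunctor κ.ord.ToType).isColimitOfIsWellOrderContinuous m hm)) x
        exact ⟨j.1, j.2, y, h⟩
      exists_iso := fun j ↦ ⟨Φ.iterationFunctorObjSuccIso j (not_isMax j), by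
        rw [Φ.iterationFunctor_map_succ j (not_isMax j), Category.assoc, Iso.inv_hom_id,
          Category.comp_id]⟩ }

end IterationChain

section WeaklyTerminal

universe v w

variable {R : Type u} [CommRing R] {𝒦 : Type w} [Category.{v} 𝒦]

namespace IterationChain

variable {U : 𝒦 ⥤ ModuleCat.{u} R} {s : 𝒦 → 𝒦} {σ : ∀ X, X ⟶ s X}
  {J : Type u} [LinearOrder J] [SuccOrder J] (Γ : IterationChain U σ J)

lemma map_a_map {i j : J} (h : i ⟶ j) (x : U.obj (Γ.F.obj i)) :
    U.map (Γ.a j) (U.map (Γ.F.map h) x) = U.map (Γ.a i) x := by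
  rw [← ConcreteCategory.comp_apply, ← U.map_comp, Γ.w]

lemma map_map {i j k : J} (h : i ⟶ j) (h' : j ⟶ k) (x : U.obj (Γ.F.obj i)) :
    U.map (Γ.F.map h') (U.map (Γ.F.map h) x) = U.map (Γ.F.map (h ≫ h')) x := by
  rw [← ConcreteCategory.comp_apply, ← U.map_comp, ← Γ.F.map_comp]

/-- Elements of a single stage which become equal in the colimit become equal at a bounded
stage. -/
lemma exists_eq_forall {κ : Cardinal.{u}}
    (hκ : ∀ (K : Type u) (f : K → J), Cardinal.mk K < κ → ∃ j, ∀ k, f k ≤ j) (i : J)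
    (hi : Cardinal.mk (U.obj (Γ.F.obj i) × U.obj (Γ.F.obj i)) < κ) :
    ∃ k, ∃ h : i ⟶ k, ∀ x y, U.map (Γ.a i) x = U.map (Γ.a i) y →
      U.map (Γ.F.map h) x = U.map (Γ.F.map h) y := by
  have (z : U.obj (Γ.F.obj i) × U.obj (Γ.F.obj i)) : ∃ k, ∃ h : i ⟶ k,
      U.map (Γ.a i) z.1 = U.map (Γ.a i) z.2 →
        U.map (Γ.F.map h) z.1 = U.map (Γ.F.map h) z.2 := by
    by_cases hz : U.map (Γ.a i) z.1 = U.map (Γ.a i) z.2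
    · obtain ⟨k, h, hk⟩ := Γ.exists_eq i z.1 z.2 hz
      exact ⟨k, h, fun _ ↦ hk⟩
    · exact ⟨i, 𝟙 i, fun h ↦ (hz h).elim⟩
  choose k h hk using this
  obtain ⟨j, hj⟩ := hκ _ k hi
  refine ⟨j, h (0, 0) ≫ homOfLE (hj _), fun x y hxy ↦ ?_⟩
  have : h (0, 0) ≫ homOfLE (hj _) = h (x, y) ≫ homOfLE (hj _) := Subsingleton.elim _ _
  rw [this, ← Γ.map_map, ← Γ.map_map, hk (x, y) hxy]

end IterationChain

/-- A weakly terminal object. -/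
def IsWeaklyTerminal (T : 𝒦) : Prop := ∀ X, Nonempty (X ⟶ T)

variable [HasFilteredColimitsOfSize.{u, u} 𝒦] (U : 𝒦 ⥤ ModuleCat.{u} R)
  [PreservesFilteredColimitsOfSize.{u, u} U]

lemma Cardinal.exists_isRegular_gt (c : Cardinal.{u}) :
    ∃ κ : Cardinal.{u}, κ.IsRegular ∧ Cardinal.aleph0 < κ ∧ c < κ := by
  refine ⟨Order.succ (max c Cardinal.aleph0), Cardinal.isRegular_succ (le_max_right _ _), ?_, ?_⟩
  · exact Order.lt_succ_of_le (le_max_right _ _)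
  · exact Order.lt_succ_of_le (le_max_left _ _)

lemma IsWeaklyTerminal.exists_injective {T : 𝒦} (hT : IsWeaklyTerminal T) :
    ∃ T' : 𝒦, IsWeaklyTerminal T' ∧ ∀ f : T' ⟶ T', Function.Injective (U.map f) := by
  have hσ (A : 𝒦) : ∃ f : A ⟶ T, Function.Injective (U.map f) →
      ∀ g : A ⟶ T, Function.Injective (U.map g) := by
    by_cases h : ∀ g : A ⟶ T, Function.Injective (U.map g)
    · exact ⟨(hT A).some, fun _ ↦ h⟩
    · push Not at h
      obtain ⟨g, hg⟩ := h
      exact ⟨g, fun h ↦ (hg h).elim⟩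
  choose σ hσ using hσ
  obtain ⟨κ, hκ, hω, hcard⟩ := Cardinal.exists_isRegular_gt (Cardinal.mk (U.obj T × U.obj T))
  obtain ⟨J, _, _, _, _, hJ, hbd, ⟨Γ⟩⟩ := exists_iterationChain U σ T κ hκ
  choose e he using Γ.exists_iso
  have hβ (i : J) := Γ.exists_eq_forall hbd (Order.succ i) (by
    refine (Cardinal.mk_congr ?_).trans_lt hcard
    have e' := (U.mapIso (e i)).toLinearEquiv.toEquiv
    exact e'.prodCongr e')
  choose β hβ₁ hβ₂ using hβ
  have hne : Nonempty J := by
    rw [← Cardinal.mk_ne_zero_iff, hJ]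
    exact hκ.ne_zero
  let i₀ := hne.some
  let seq : ℕ → J := fun n ↦ β^[n] i₀
  have hseq (n) : seq (n + 1) = β (seq n) := Function.iterate_succ_apply' _ _ _
  have hlt (n) : seq n < seq (n + 1) :=
    (Order.lt_succ _).trans_le ((leOfHom (hβ₁ (seq n))).trans (hseq n).ge)
  obtain ⟨b, hb⟩ := hbd (ULift ℕ) (fun n ↦ seq n.down) (by simpa using hω)
  obtain ⟨δ, hδ, hδmin⟩ := WellFounded.has_min (wellFounded_lt (α := J)) {j | ∀ n, seq n ≤ j}
    ⟨b, fun n ↦ hb ⟨n⟩⟩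
  have hseqδ (n) : seq n < δ := (hlt n).trans_le (hδ _)
  have hlub : IsLUB (Set.range seq) δ :=
    ⟨by rintro _ ⟨n, rfl⟩; exact hδ n, fun j hj ↦
      le_of_not_gt fun h ↦ hδmin j (fun n ↦ hj ⟨n, rfl⟩) h⟩
  have hlim : Order.IsSuccLimit δ := hlub.isSuccLimit_of_notMem (Set.range_nonempty _) (by
    rintro ⟨n, hn⟩
    exact (hseqδ n).ne hn)
  have hex (j : J) (hj : j < δ) : ∃ n, j < seq n := by
    by_contra! h
    exact hδmin j h hj
  have hrep (x : U.obj (Γ.F.obj δ)) : ∃ n, ∀ m ≥ n, ∃ h : Order.succ (seq m) ⟶ δ,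
      ∃ y, U.map (Γ.F.map h) y = x := by
    obtain ⟨j, hj, y, hy⟩ := Γ.exists_rep_of_isSuccLimit δ hlim x
    obtain ⟨n, hn⟩ := hex j hj
    refine ⟨n, fun m hm ↦ ⟨homOfLE (Order.succ_le_of_lt (hseqδ m)), U.map (Γ.F.map (homOfLE ?_)) y,
      ?_⟩⟩
    · exact hn.le.trans (((strictMono_nat_of_lt_succ hlt).monotone hm).trans (Order.le_succ _))
    · rw [Γ.map_map]
      exact hy
  have hinj : Function.Injective (U.map (Γ.a δ)) := by
    intro x y hxy
    obtain ⟨n, hn⟩ := hrep x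
    obtain ⟨m, hm⟩ := hrep y
    obtain ⟨h, x, rfl⟩ := hn (max n m) (le_max_left _ _)
    obtain ⟨h', y, rfl⟩ := hm (max n m) (le_max_right _ _)
    obtain rfl : h = h' := Subsingleton.elim _ _
    rw [Γ.map_a_map, Γ.map_a_map] at hxy
    have := hβ₂ _ x y hxy
    have hh : h = hβ₁ (seq (max n m)) ≫ homOfLE (by rw [← hseq]; exact hδ _) :=
      Subsingleton.elim _ _
    rw [hh, ← Γ.map_map, ← Γ.map_map, this]
  have hinj' : Function.Injective (U.map (σ (Γ.F.obj δ))) := by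
    rw [← he, U.map_comp, ConcreteCategory.coe_comp]
    refine (U.mapIso (e δ)).toLinearEquiv.injective.comp fun x y hxy ↦ hinj ?_
    rw [← Γ.map_a_map (homOfLE (Order.le_succ δ)) x, hxy, Γ.map_a_map]
  have hlt' : Order.succ i₀ ≤ δ := Order.succ_le_of_lt (hseqδ 0)
  refine ⟨Γ.F.obj δ, fun X ↦ ⟨(hT X).some ≫ (e i₀).inv ≫ Γ.F.map (homOfLE hlt')⟩, fun f ↦ ?_⟩
  have := hσ _ hinj' (f ≫ σ _)
  rw [U.map_comp, ConcreteCategory.coe_comp] at this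
  exact this.of_comp

lemma IsWeaklyTerminal.exists_bijective {T : 𝒦} (hT : IsWeaklyTerminal T)
    (hinj : ∀ f : T ⟶ T, Function.Injective (U.map f)) (f : T ⟶ T) :
    Function.Bijective (U.map f) := by
  refine ⟨hinj f, ?_⟩
  by_contra hf
  have hσ (A : 𝒦) : ∃ g : A ⟶ T, Nonempty (A ≅ T) → ¬ Function.Surjective (U.map g) := by
    by_cases h : Nonempty (A ≅ T)
    · obtain ⟨e⟩ := h
      refine ⟨e.hom ≫ f, fun _ h ↦ hf ?_⟩
      rw [U.map_comp, ConcreteCategory.coe_comp] at h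
      exact h.of_comp
    · exact ⟨(hT A).some, fun h' ↦ (h h').elim⟩
  choose σ hσ using hσ
  obtain ⟨κ, hκ, -, hcard⟩ := Cardinal.exists_isRegular_gt (Cardinal.mk (U.obj T))
  obtain ⟨J, _, _, _, _, hJ, -, ⟨Γ⟩⟩ := exists_iterationChain U σ T κ hκ
  choose e he using Γ.exists_iso
  obtain ⟨g⟩ := hT Γ.B
  have hinj' (j : J) : Function.Injective (U.map (Γ.a (Order.succ j) ≫ g)) := by
    have := hinj ((e j).inv ≫ Γ.a (Order.succ j) ≫ g)
    rw [U.map_comp, ConcreteCategory.coe_comp] at this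
    intro x y hxy
    have inv (z) : U.map (e j).inv (U.map (e j).hom z) = z := by
      rw [← ConcreteCategory.comp_apply, ← U.map_comp, Iso.hom_inv_id, U.map_id]
      rfl
    rw [← inv x, ← inv y] at hxy
    rw [← inv x, ← inv y, this hxy]
  have ha (j : J) : Function.Injective (U.map (Γ.a (Order.succ j))) := by
    have := hinj' j
    rw [U.map_comp, ConcreteCategory.coe_comp] at this
    exact this.of_comp
  have hg : Function.Injective (U.map g) := by
    intro x y hxy
    obtain ⟨i, x, rfl⟩ := Γ.exists_rep x
    obtain ⟨j, y, rfl⟩ := Γ.exists_rep y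
    have hi : i ≤ Order.succ (max i j) := (le_max_left _ _).trans (Order.le_succ _)
    have hj : j ≤ Order.succ (max i j) := (le_max_right _ _).trans (Order.le_succ _)
    rw [← Γ.map_a_map (homOfLE hi), ← Γ.map_a_map (homOfLE hj)] at hxy ⊢
    refine congrArg _ (hinj' _ ?_)
    rw [U.map_comp]
    exact hxy
  have hb (j : J) : ∃ z : U.obj (Γ.F.obj (Order.succ (Order.succ j))),
      U.map (Γ.a _) z ∉ Set.range (U.map (Γ.a (Order.succ j))) := by
    have := hσ (Γ.F.obj (Order.succ j)) ⟨e j⟩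
    rw [← he, U.map_comp, ConcreteCategory.coe_comp] at this
    have h2 : ¬ Function.Surjective (U.map (Γ.F.map (homOfLE (Order.le_succ (Order.succ j))))) :=
      fun h ↦ this ((U.mapIso (e (Order.succ j))).toLinearEquiv.surjective.comp h)
    simp only [Function.Surjective, not_forall] at h2
    obtain ⟨z, hz⟩ := h2
    refine ⟨z, fun ⟨y, hy⟩ ↦ hz ⟨y, ha _ ?_⟩⟩
    rw [Γ.map_a_map, hy]
  choose z hz using hb
  have hne {i j : J} (hij : i < j) : U.map (Γ.a _) (z i) ≠ U.map (Γ.a _) (z j) := by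
    intro h
    refine hz j ⟨U.map (Γ.F.map (homOfLE (Order.succ_le_succ (Order.succ_le_of_lt hij)))) (z i), ?_⟩
    rw [Γ.map_a_map, h]
  have hJB : Cardinal.mk J ≤ Cardinal.mk (U.obj T) := by
    refine Cardinal.mk_le_of_injective
      (f := fun j ↦ U.map g (U.map (Γ.a _) (z j))) fun i j hij ↦ ?_
    have hij := hg hij
    rcases lt_trichotomy i j with h | h | h
    · exact (hne h hij).elim
    · exact h
    · exact (hne h hij.symm).elim
  exact (hJ ▸ hJB).not_gt hcard

/-- In a category with filtered colimits which are computed in modules, a weakly terminal object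
can be improved to one all of whose endomorphisms are isomorphisms. -/
theorem IsWeaklyTerminal.exists_isIso [U.ReflectsIsomorphisms] {T : 𝒦} (hT : IsWeaklyTerminal T) :
    ∃ T' : 𝒦, IsWeaklyTerminal T' ∧ ∀ f : T' ⟶ T', IsIso f := by
  obtain ⟨T', hT', hinj⟩ := hT.exists_injective U
  refine ⟨T', hT', fun f ↦ ?_⟩
  have : IsIso (U.map f) := by
    rw [ConcreteCategory.isIso_iff_bijective]
    exact hT'.exists_bijective U hinj f
  exact isIso_of_reflects_iso f U

end WeaklyTerminal

section FilteredColimits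

variable {R : Type u} [CommRing R] {I : Type u} [SmallCategory I] [IsFiltered I]
  {F : I ⥤ ModuleCat.{u} R} {c : Cocone F}

lemma CategoryTheory.Limits.IsColimit.exists_lTensor_eq (hc : IsColimit c) (A : ModuleCat.{u} R)
    (x : A ⊗[R] c.pt) :
    ∃ i y, (c.ι.app i).hom.lTensor A y = x :=
  have h := Concrete.isColimit_exists_rep _
    (isColimitOfPreserves (MonoidalCategory.tensorLeft A) hc)
  h x

lemma CategoryTheory.Limits.IsColimit.exists_lTensor_eq_zero (hc : IsColimit c)
    (A : ModuleCat.{u} R) {i : I} (x : A ⊗[R] F.obj i) (hx : (c.ι.app i).hom.lTensor A x = 0) :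
    ∃ (j : I) (f : i ⟶ j), (F.map f).hom.lTensor A x = 0 := by
  obtain ⟨j, f, g, h⟩ := Concrete.isColimit_exists_of_rep_eq _
    (isColimitOfPreserves (MonoidalCategory.tensorLeft A) hc) (i := i) (j := i) x 0
    (hx.trans (map_zero ((c.ι.app i).hom.lTensor A)).symm)
  exact ⟨j, f, h.trans (map_zero ((F.map g).hom.lTensor A))⟩

lemma CategoryTheory.Limits.IsColimit.exists_eq_zero (hc : IsColimit c) {i : I}
    (x : F.obj i) (hx : c.ι.app i x = 0) :
    ∃ (j : I) (f : i ⟶ j), F.map f x = 0 := by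
  obtain ⟨j, f, g, h⟩ := Concrete.isColimit_exists_of_rep_eq _ hc (i := i) (j := i) x 0
    (hx.trans (map_zero (c.ι.app i).hom).symm)
  exact ⟨j, f, h.trans (map_zero (F.map g).hom)⟩

lemma LinearMap.lTensor_lTensor_of_forall {A M N L : Type u} [AddCommGroup A] [Module R A]
    [AddCommGroup M] [Module R M] [AddCommGroup N] [Module R N] [AddCommGroup L] [Module R L]
    {f : N →ₗ[R] L} {g : M →ₗ[R] N} {h : M →ₗ[R] L} (w : ∀ m, f (g m) = h m) (x : A ⊗[R] M) :
    f.lTensor A (g.lTensor A x) = h.lTensor A x := by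
  obtain rfl : f ∘ₗ g = h := LinearMap.ext w
  rw [LinearMap.lTensor_comp, LinearMap.comp_apply]

lemma ExactnessTest.Holds.of_isColimit {t : ExactnessTest R} (hc : IsColimit c)
    (h : ∀ i, t.Holds (F.obj i)) : t.Holds c.pt := by
  intro x hx
  obtain ⟨i, x, rfl⟩ := hc.exists_lTensor_eq _ x
  rw [LinearMap.rTensor_lTensor_apply] at hx
  obtain ⟨j, f, hf⟩ := hc.exists_lTensor_eq_zero _ _ hx
  rw [← LinearMap.rTensor_lTensor_apply] at hf
  obtain ⟨y, hy⟩ := h j _ hf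
  refine ⟨(c.ι.app j).hom.lTensor _ y, ?_⟩
  rw [LinearMap.rTensor_lTensor_apply, hy]
  exact LinearMap.lTensor_lTensor_of_forall (ConcreteCategory.congr_hom (c.w f)) x

end FilteredColimits

section TestCategories

variable {R : Type u} [CommRing R] {ι : Type} (t : ι → ExactnessTest R)

instance (I : Type u) [SmallCategory I] [IsFiltered I] :
    ObjectProperty.IsClosedUnderColimitsOfShape
      (fun M : ModuleCat.{u} R ↦ PassesTests t M) I where
  colimitsOfShape_le := by
    rintro X ⟨p⟩
    exact fun i ↦ .of_isColimit p.isColimit fun j ↦ p.prop_diag_obj j i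

variable {M : ModuleCat.{u} R}

/-- The modules over `M` which pass the tests. -/
abbrev testOver (M : ModuleCat.{u} R) : ObjectProperty (Over M) :=
  ObjectProperty.inverseImage (fun M : ModuleCat.{u} R ↦ PassesTests t M) (Over.forget M)

/-- The extensions of `M` by modules which pass the tests. -/
def testUnder (M : ModuleCat.{u} R) : ObjectProperty (Under M) := fun X ↦
  Function.Injective X.hom.hom ∧ PassesTests t (X.right ⧸ LinearMap.range X.hom.hom)

instance (I : Type u) [SmallCategory I] [IsFiltered I] :
    (testUnder t M).IsClosedUnderColimitsOfShape I where
  colimitsOfShape_le := by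
    rintro X ⟨p⟩
    have : IsConnected I := IsFiltered.isConnected I
    have : PreservesColimitsOfShape I (Under.forget M) := inferInstance
    have hc := isColimitOfPreserves (Under.forget M) p.isColimit
    have hw (i : I) (m : M) : (p.ι.app i).right ((p.diag.obj i).hom m) = X.hom m :=
      ConcreteCategory.congr_hom (Under.w (p.ι.app i)) m
    have hw' {i j : I} (f : i ⟶ j) (m : M) :
        (p.diag.map f).right ((p.diag.obj i).hom m) = (p.diag.obj j).hom m :=
      ConcreteCategory.congr_hom (Under.w (p.diag.map f)) m
    obtain ⟨i₀⟩ : Nonempty I := IsFiltered.nonempty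
    constructor
    · rw [injective_iff_map_eq_zero]
      intro m hm
      obtain ⟨j, f, hf⟩ := hc.exists_eq_zero ((p.diag.obj i₀).hom m) ((hw i₀ m).trans hm)
      exact (injective_iff_map_eq_zero _).1 (p.prop_diag_obj j).1 m ((hw' f m).symm.trans hf)
    · intro k
      rw [ExactnessTest.holds_of_exact_iff (LinearMap.exact_map_mkQ_range X.hom.hom)
        (Submodule.mkQ_surjective _)]
      rintro x ⟨m, hm⟩
      obtain ⟨i, (x : (t k).B ⊗[R] (p.diag.obj i).right), rfl⟩ := hc.exists_lTensor_eq _ x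
      have hl (A : ModuleCat.{u} R) {i : I} (m : A ⊗[R] M) :
          (p.ι.app i).right.hom.lTensor A ((p.diag.obj i).hom.hom.lTensor A m) =
            X.hom.hom.lTensor A m := by
        exact LinearMap.lTensor_lTensor_of_forall (hw i) m
      have hl' (A : ModuleCat.{u} R) {i j : I} (f : i ⟶ j) (m : A ⊗[R] M) :
          (p.diag.map f).right.hom.lTensor A ((p.diag.obj i).hom.hom.lTensor A m) =
            (p.diag.obj j).hom.hom.lTensor A m := by
        exact LinearMap.lTensor_lTensor_of_forall (hw' f) m
      have hz : (p.ι.app i).right.hom.lTensor (t k).D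
          ((t k).g.rTensor _ x - (p.diag.obj i).hom.hom.lTensor (t k).D m) = 0 := by
        rw [map_sub, hl, hm, ← LinearMap.rTensor_lTensor_apply]
        exact sub_self _
      obtain ⟨j, f, hf⟩ := hc.exists_lTensor_eq_zero _ _ hz
      have hf' : (p.diag.map f).right.hom.lTensor (t k).D
          ((t k).g.rTensor _ x - (p.diag.obj i).hom.hom.lTensor (t k).D m) = 0 := hf
      rw [map_sub, hl', ← LinearMap.rTensor_lTensor_apply, sub_eq_zero] at hf'
      obtain ⟨y, m', h⟩ := (ExactnessTest.holds_of_exact_iff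
        (LinearMap.exact_map_mkQ_range (p.diag.obj j).hom.hom)
        (Submodule.mkQ_surjective _)).1 ((p.prop_diag_obj j).2 k) _ ⟨m, hf'.symm⟩
      refine ⟨(p.ι.app j).right.hom.lTensor _ y, m', ?_⟩
      have hpw : (p.ι.app j).right.hom.lTensor (t k).B ((p.diag.map f).right.hom.lTensor _ x) =
          (p.ι.app i).right.hom.lTensor (t k).B x :=
        LinearMap.lTensor_lTensor_of_forall (fun e ↦ ConcreteCategory.congr_hom
          (congrArg CommaMorphism.right (p.w f)) e) x
      rw [LinearMap.rTensor_lTensor_apply, ← hl (t k).B m', ← map_add, ← h, hpw]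
      rfl

instance : HasFilteredColimitsOfSize.{u, u} (testOver t M).FullSubcategory where
  HasColimitsOfShape _ _ _ := inferInstance

instance : HasFilteredColimitsOfSize.{u, u} (testUnder t M).FullSubcategory where
  HasColimitsOfShape I _ _ := by
    have : IsConnected I := IsFiltered.isConnected I
    infer_instance

instance : PreservesFilteredColimitsOfSize.{u, u} ((testOver t M).ι ⋙ Over.forget M) where
  preserves_filtered_colimits _ _ _ := inferInstance

instance : PreservesFilteredColimitsOfSize.{u, u} ((testUnder t M).ι ⋙ Under.forget M) where
  preserves_filtered_colimits I _ _ := by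
    have : IsConnected I := IsFiltered.isConnected I
    infer_instance

end TestCategories

section SpecialPreenvelope

variable {R : Type u} [CommRing R]

/-- Maps from a small module to the colimit of a long chain factor through some stage. -/
lemma IterationChain.exists_factorization {𝒦 : Type*} [Category 𝒦] {U : 𝒦 ⥤ ModuleCat.{u} R}
    {s : 𝒦 → 𝒦} {σ : ∀ X, X ⟶ s X} {J : Type u} [LinearOrder J] [SuccOrder J]
    (Γ : IterationChain U σ J) {κ : Cardinal.{u}}
    (hκ : ∀ (K : Type u) (f : K → J), Cardinal.mk K < κ → ∃ j, ∀ k, f k ≤ j)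
    {L : Type u} [AddCommGroup L] [Module R L] (hL : Cardinal.mk (L × L) < κ)
    (hRL : Cardinal.mk (R × L) < κ) (f : L →ₗ[R] U.obj Γ.B) :
    ∃ (k : J) (g : L →ₗ[R] U.obj (Γ.F.obj k)), (U.map (Γ.a k)).hom ∘ₗ g = f := by
  choose i x hx using fun l ↦ Γ.exists_rep (f l)
  obtain ⟨j, hj⟩ := hκ L i ((Cardinal.mk_le_of_injective
    (f := fun l : L ↦ (l, l)) fun _ _ h ↦ congrArg Prod.fst h).trans_lt hL)
  let y (l : L) : U.obj (Γ.F.obj j) := U.map (Γ.F.map (homOfLE (hj l))) (x l)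
  have hy (l : L) : U.map (Γ.a j) (y l) = f l := (Γ.map_a_map _ _).trans (hx l)
  have hadd (l : L × L) := Γ.exists_eq j (y (l.1 + l.2)) (y l.1 + y l.2) (by
    rw [map_add, hy, hy, hy, map_add])
  have hsmul (l : R × L) := Γ.exists_eq j (y (l.1 • l.2)) (l.1 • y l.2) (by
    rw [map_smul, hy, hy, map_smul])
  choose k h hk using hadd
  choose k' h' hk' using hsmul
  obtain ⟨m, hm⟩ := hκ _ k hL
  obtain ⟨m', hm'⟩ := hκ _ k' hRL
  have H : j ⟶ max m m' := h 0 ≫ homOfLE ((hm 0).trans (le_max_left _ _))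
  refine ⟨max m m', ⟨⟨fun l ↦ U.map (Γ.F.map H) (y l), fun l l' ↦ ?_⟩, fun r l ↦ ?_⟩, ?_⟩
  · have : H = h (l, l') ≫ homOfLE ((hm _).trans (le_max_left _ _)) := Subsingleton.elim _ _
    rw [← map_add, this, ← Γ.map_map, hk (l, l'), Γ.map_map]
  · change U.map (Γ.F.map H) (y (r • l)) = _
    have : H = h' (r, l) ≫ homOfLE ((hm' _).trans (le_max_right _ _)) := Subsingleton.elim _ _
    rw [RingHom.id_apply, ← map_smul, this, ← Γ.map_map, hk' (r, l), Γ.map_map]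
  · ext l
    exact (Γ.map_a_map _ _).trans (hy l)

variable {ι : Type} {t : ι → ExactnessTest R}

lemma Module.exists_injective_extending (E : Type u) [AddCommGroup E] [Module R E] :
    ∃ (I : ModuleCat.{u} R) (e : E →ₗ[R] I), Function.Injective e ∧
      ∀ (P : Type u) [AddCommGroup P] [Module R P] (L : Submodule R P) (f : L →ₗ[R] I),
        ∃ h : P →ₗ[R] I, h ∘ₗ L.subtype = f := by
  obtain ⟨⟨I, hI, e, he⟩⟩ := EnoughInjectives.presentation (ModuleCat.of R E)
  refine ⟨I, e.hom, (ModuleCat.mono_iff_injective _).1 he, fun P _ _ L f ↦ ?_⟩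
  have hm : Mono (ModuleCat.ofHom L.subtype) :=
    (ModuleCat.mono_iff_injective _).2 L.subtype_injective
  obtain ⟨h, hh⟩ := hI.factors (ModuleCat.ofHom f) (ModuleCat.ofHom L.subtype)
  exact ⟨h.hom, congrArg ModuleCat.Hom.hom hh⟩

lemma exists_extension_step (P E : Type u) [AddCommGroup P] [Module R P] [AddCommGroup E]
    [Module R E] : ∃ (E' V : ModuleCat.{u} R) (i : E →ₗ[R] E') (p : E' →ₗ[R] V),
      Function.Injective i ∧ Function.Exact i p ∧ Function.Surjective p ∧ PassesTests t V ∧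
      ∀ L : Submodule R P, PassesTests t (P ⧸ L) → ∀ f : L →ₗ[R] E,
        ∃ g : P →ₗ[R] E', g ∘ₗ L.subtype = i ∘ₗ f := by
  classical
  obtain ⟨I, e, he, hI⟩ := Module.exists_injective_extending (R := R) E
  let Q := LinearMap.range e
  let S := Σ L : {L : Submodule R P // PassesTests t (P ⧸ L)}, (P ⧸ L.1) →ₗ[R] I ⧸ Q
  let V := DirectSum S fun s ↦ P ⧸ s.1.1
  let Θ : V →ₗ[R] I ⧸ Q := DirectSum.toModule R S _ fun s ↦ s.2
  let K : Submodule R (I × V) :=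
    LinearMap.eqLocus (Q.mkQ ∘ₗ LinearMap.fst R I V) (Θ ∘ₗ LinearMap.snd R I V)
  have hK (k : K) : Q.mkQ k.1.1 = Θ k.1.2 := k.2
  have hQ (x : E) : Q.mkQ (e x) = 0 := (Submodule.Quotient.mk_eq_zero _).2 ⟨x, rfl⟩
  let a : E →ₗ[R] K := (LinearMap.inl R I V ∘ₗ e).codRestrict K fun x ↦
    (hQ x).trans (map_zero Θ).symm
  refine ⟨ModuleCat.of R K, ModuleCat.of R V, a, LinearMap.snd R I V ∘ₗ K.subtype,
    fun x y hxy ↦ he (congrArg (fun k : K ↦ k.1.1) hxy), fun k ↦ ⟨fun hk ↦ ?_, ?_⟩, fun v ↦ ?_,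
    .directSum fun s ↦ s.1.2, fun L hL f ↦ ?_⟩
  · have hk : k.1.2 = 0 := hk
    have := hK k
    rw [hk, map_zero] at this
    obtain ⟨x, hx⟩ := (Submodule.Quotient.mk_eq_zero _).1 this
    exact ⟨x, Subtype.ext (Prod.ext hx hk.symm)⟩
  · rintro ⟨x, rfl⟩
    rfl
  · obtain ⟨x, hx⟩ := Q.mkQ_surjective (Θ v)
    exact ⟨⟨(x, v), hx⟩, rfl⟩
  · obtain ⟨h, hh⟩ := hI P L (e ∘ₗ f)
    have hhL (x : L) : h x.1 = e (f x) := LinearMap.congr_fun hh x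
    let s : S := ⟨⟨L, hL⟩, L.liftQ (Q.mkQ ∘ₗ h) fun x hx ↦ by
      rw [LinearMap.mem_ker, LinearMap.comp_apply, hhL ⟨x, hx⟩, hQ]⟩
    refine ⟨(h.prod (DirectSum.lof R S (fun s ↦ P ⧸ s.1.1) s ∘ₗ L.mkQ)).codRestrict K fun x ↦ ?_,
      ?_⟩
    · change Q.mkQ (h x) = Θ (DirectSum.lof R S (fun s ↦ P ⧸ s.1.1) s (L.mkQ x))
      rw [DirectSum.toModule_lof]
      rfl
    · ext x : 1
      refine Subtype.ext (Prod.ext (hhL x) ?_)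
      change DirectSum.lof R S (fun s ↦ P ⧸ s.1.1) s (L.mkQ x) = 0
      rw [show L.mkQ x = 0 from (Submodule.Quotient.mk_eq_zero _).2 x.2, map_zero]

variable (t) in
/-- The class of modules passing a family of tests is closed under extensions. -/
def ClosedUnderExtensions : Prop :=
  ∀ (K M N : Type u) [AddCommGroup K] [Module R K] [AddCommGroup M] [Module R M] [AddCommGroup N]
    [Module R N] (i : K →ₗ[R] M) (p : M →ₗ[R] N), Function.Injective i → Function.Exact i p →
    Function.Surjective p → PassesTests t K → PassesTests t N → PassesTests t M

lemma PassesTests.of_exact {M N V : Type u} [AddCommGroup M] [Module R M] [AddCommGroup N]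
    [Module R N] [AddCommGroup V] [Module R V] (hV : PassesTests t V) {i : M →ₗ[R] N}
    {p : N →ₗ[R] V} (hip : Function.Exact i p) (hp : Function.Surjective p) :
    PassesTests t (N ⧸ LinearMap.range i) := by
  obtain h : LinearMap.ker p = LinearMap.range i := LinearMap.exact_iff.1 hip
  rw [← h]
  exact hV.congr (p.quotKerEquivOfSurjective hp).symm

lemma PassesTests.quotient_range_comp (hext : ClosedUnderExtensions t) {M E E' : Type u}
    [AddCommGroup M] [Module R M] [AddCommGroup E] [Module R E] [AddCommGroup E'] [Module R E']
    {i : M →ₗ[R] E} {j : E →ₗ[R] E'} (hj : Function.Injective j)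
    (h : PassesTests t (E ⧸ LinearMap.range i)) (h' : PassesTests t (E' ⧸ LinearMap.range j)) :
    PassesTests t (E' ⧸ LinearMap.range (j ∘ₗ i)) := by
  have hle : LinearMap.range i ≤ (LinearMap.range (j ∘ₗ i)).comap j := by
    rintro _ ⟨x, rfl⟩
    exact ⟨x, rfl⟩
  have hle' : LinearMap.range (j ∘ₗ i) ≤ LinearMap.range j := LinearMap.range_comp_le_range i j
  refine hext _ _ _ ((LinearMap.range i).mapQ (LinearMap.range (j ∘ₗ i)) j hle)
    (Submodule.factor hle') ?_ ?_ (Submodule.factor_surjective hle') h h'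
  · rw [injective_iff_map_eq_zero]
    intro x hx
    obtain ⟨x, rfl⟩ := Submodule.mkQ_surjective _ x
    obtain ⟨y, hy⟩ := (Submodule.Quotient.mk_eq_zero _).1 hx
    exact (Submodule.Quotient.mk_eq_zero _).2 ⟨y, hj hy⟩
  · intro x
    obtain ⟨x, rfl⟩ := Submodule.mkQ_surjective _ x
    constructor
    · intro hx
      obtain ⟨y, rfl⟩ := (Submodule.Quotient.mk_eq_zero _).1 hx
      exact ⟨Submodule.mkQ _ y, rfl⟩
    · rintro ⟨y, hy⟩
      obtain ⟨y, rfl⟩ := Submodule.mkQ_surjective _ y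
      rw [← hy]
      exact (Submodule.Quotient.mk_eq_zero _).2 ⟨y, rfl⟩

variable (t) in
/-- The module `E` has no nontrivial extensions by modules passing the tests. -/
def IsOrthogonal (E : Type u) [AddCommGroup E] [Module R E] : Prop :=
  ∀ (X : Type u) [AddCommGroup X] [Module R X], PassesTests t X → HasExtensions R X E

theorem exists_testUnder_isOrthogonal (hext : ClosedUnderExtensions t)
    (h0 : PassesTests t PUnit.{u + 1}) (M : ModuleCat.{u} R) :
    ∃ T : (testUnder t M).FullSubcategory, IsOrthogonal t T.1.right := by
  obtain ⟨S, hS⟩ := exists_bounded_passesTests t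
  have step (X : (testUnder t M).FullSubcategory) : ∃ (Y : (testUnder t M).FullSubcategory)
      (σ : X ⟶ Y), ∀ L : Submodule R (S →₀ R), PassesTests t ((S →₀ R) ⧸ L) →
        ∀ f : L →ₗ[R] X.1.right, ∃ g : (S →₀ R) →ₗ[R] Y.1.right,
          g ∘ₗ L.subtype = σ.hom.right.hom ∘ₗ f := by
    obtain ⟨E', V, i, p, hi, hip, hp, hV, h⟩ :=
      exists_extension_step (t := t) (S →₀ R) X.1.right
    let Y : Under M := Under.mk (X.1.hom ≫ ModuleCat.ofHom i)
    exact ⟨⟨Y, hi.comp X.2.1, .quotient_range_comp hext hi X.2.2 (hV.of_exact hip hp)⟩,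
      ObjectProperty.homMk (Under.homMk (ModuleCat.ofHom i)), h⟩
  choose s σ hσ using step
  let X₀ : (testUnder t M).FullSubcategory := ⟨Under.mk (𝟙 M), Function.injective_id, by
    refine h0.of_exact (p := (0 : M →ₗ[R] PUnit.{u + 1})) (fun x ↦ ⟨fun _ ↦ ⟨x, rfl⟩, fun _ ↦ rfl⟩)
      fun _ ↦ ⟨0, rfl⟩⟩
  let P := S →₀ R
  obtain ⟨κ, hκ, -, hc⟩ := Cardinal.exists_isRegular_gt
    (Cardinal.mk (P × P) + Cardinal.mk (R × P))
  obtain ⟨J, _, _, _, _, hJ, hbd, ⟨Γ⟩⟩ :=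
    exists_iterationChain ((testUnder t M).ι ⋙ Under.forget M) σ X₀ κ hκ
  refine ⟨Γ.B, fun X _ _ hX ↦ .of_bounded hS (fun L hL f ↦ ?_) hX⟩
  have h1 : Cardinal.mk (L × L) < κ := ((Cardinal.mk_le_of_injective
    (L.subtype_injective.prodMap L.subtype_injective)).trans (self_le_add_right _ _)).trans_lt hc
  have h2 : Cardinal.mk (R × L) < κ := ((Cardinal.mk_le_of_injective
    (Function.injective_id.prodMap L.subtype_injective)).trans (self_le_add_left _ _)).trans_lt hc
  obtain ⟨k, f', rfl⟩ := Γ.exists_factorization hbd h1 h2 f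
  obtain ⟨e, he⟩ := Γ.exists_iso k
  obtain ⟨g, hg⟩ := hσ _ L hL f'
  refine ⟨(e.inv ≫ Γ.a (Order.succ k)).hom.right.hom ∘ₗ g, ?_⟩
  have : σ (Γ.F.obj k) ≫ e.inv ≫ Γ.a (Order.succ k) = Γ.a k := by
    rw [← he, Category.assoc, Iso.hom_inv_id_assoc, Γ.w]
  rw [LinearMap.comp_assoc, hg, ← this]
  rfl

end SpecialPreenvelope

section Envelopes

variable {R : Type u} [CommRing R] {ι : Type} {t : ι → ExactnessTest R}

lemma IsOrthogonal.exists_extension {M E G : Type u} [AddCommGroup M] [Module R M]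
    [AddCommGroup E] [Module R E] [AddCommGroup G] [Module R G] (hG : IsOrthogonal t G)
    {i : M →ₗ[R] E} (hi : Function.Injective i) (h : PassesTests t (E ⧸ LinearMap.range i))
    (f : M →ₗ[R] G) : ∃ g : E →ₗ[R] G, g ∘ₗ i = f :=
  hG _ h _ _ i _ hi (LinearMap.exact_map_mkQ_range i) (Submodule.mkQ_surjective _) f

theorem exists_orthogonal_envelope (hR : PassesTests t R) (hext : ClosedUnderExtensions t)
    (M : ModuleCat.{u} R) : ∃ (E : ModuleCat.{u} R) (φ : M ⟶ E), IsOrthogonal t E ∧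
      (∀ E' : ModuleCat.{u} R, IsOrthogonal t E' → ∀ φ' : M ⟶ E', ∃ ψ : E ⟶ E', φ ≫ ψ = φ') ∧
      ∀ f : E ⟶ E, φ ≫ f = φ → IsIso f := by
  obtain ⟨B, hB⟩ := exists_testUnder_isOrthogonal hext (.of_projective hR _) M
  have hw : IsWeaklyTerminal B := fun X ↦ by
    obtain ⟨g, hg⟩ := hB.exists_extension X.2.1 X.2.2 B.1.hom.hom
    exact ⟨ObjectProperty.homMk (Under.homMk (ModuleCat.ofHom g) (ModuleCat.hom_ext hg))⟩
  obtain ⟨T, hT, hiso⟩ := hw.exists_isIso ((testUnder t M).ι ⋙ Under.forget M)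
  obtain ⟨a⟩ := hT B
  obtain ⟨b⟩ := hw T
  have := hiso (b ≫ a)
  refine ⟨T.1.right, T.1.hom, fun X _ _ hX ↦ ?_, fun E' hE' φ' ↦ ?_, fun f hf ↦ ?_⟩
  · refine (hB X hX).of_retract b.hom.right.hom (a ≫ inv (b ≫ a)).hom.right.hom ?_
    have h : b ≫ a ≫ inv (b ≫ a) = 𝟙 T := by rw [← Category.assoc, IsIso.hom_inv_id]
    exact congrArg (fun k : T ⟶ T ↦ k.hom.right.hom) h
  · obtain ⟨g, hg⟩ := hE'.exists_extension T.2.1 T.2.2 φ'.hom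
    exact ⟨ModuleCat.ofHom g, ModuleCat.hom_ext hg⟩
  · let f' : T ⟶ T := ObjectProperty.homMk (Under.homMk f hf)
    have := hiso f'
    exact inferInstanceAs (IsIso (((testUnder t M).ι ⋙ Under.forget M).map f'))

lemma LinearMap.exists_pushout {K P E N : Type u} [AddCommGroup K] [Module R K] [AddCommGroup P]
    [Module R P] [AddCommGroup E] [Module R E] [AddCommGroup N] [Module R N] {k : K →ₗ[R] P}
    {q : P →ₗ[R] N} (hk : Function.Injective k) (hkq : Function.Exact k q)
    (hq : Function.Surjective q) {i : K →ₗ[R] E} (hi : Function.Injective i) :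
    ∃ (F : ModuleCat.{u} R) (j : E →ₗ[R] F) (p : F →ₗ[R] N) (a : P →ₗ[R] F)
      (b : F →ₗ[R] E ⧸ LinearMap.range i), Function.Injective j ∧ Function.Exact j p ∧
      Function.Surjective p ∧ Function.Injective a ∧ Function.Exact a b ∧
      Function.Surjective b := by
  let Q := LinearMap.range (k.prod (-i))
  have hQ (z : P × E) : Q.mkQ z = 0 ↔ ∃ x, k x = z.1 ∧ - i x = z.2 := by
    rw [Submodule.mkQ_apply, Submodule.Quotient.mk_eq_zero]
    exact exists_congr fun x ↦ Prod.ext_iff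
  let I := LinearMap.range i
  let p : (P × E) ⧸ Q →ₗ[R] N := Q.liftQ (q ∘ₗ LinearMap.fst R P E) (by
    rintro _ ⟨x, rfl⟩
    exact hkq.apply_apply_eq_zero x)
  let b : (P × E) ⧸ Q →ₗ[R] E ⧸ I := Q.liftQ (I.mkQ ∘ₗ LinearMap.snd R P E) (by
    rintro _ ⟨x, rfl⟩
    exact (Submodule.Quotient.mk_eq_zero _).2 ⟨-x, map_neg i x⟩)
  have hp (z : P × E) : p (Q.mkQ z) = q z.1 := rfl
  have hb (z : P × E) : b (Q.mkQ z) = I.mkQ z.2 := rfl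
  refine ⟨ModuleCat.of R ((P × E) ⧸ Q), Q.mkQ ∘ₗ LinearMap.inr R P E, p,
    Q.mkQ ∘ₗ LinearMap.inl R P E, b, (injective_iff_map_eq_zero _).2 fun e he ↦ ?_, fun z ↦ ?_,
    fun n ↦ ?_, (injective_iff_map_eq_zero _).2 fun x hx ↦ ?_, fun z ↦ ?_, fun e ↦ ?_⟩
  · obtain ⟨x, hx, rfl⟩ := (hQ _).1 he
    rw [(injective_iff_map_eq_zero k).1 hk x hx, map_zero, neg_zero]
  · obtain ⟨⟨x, e⟩, rfl⟩ := Q.mkQ_surjective z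
    constructor
    · intro h
      obtain ⟨y, rfl⟩ := (hkq x).1 h
      refine ⟨e + i y, ?_⟩
      rw [LinearMap.comp_apply, ← sub_eq_zero, ← map_sub]
      exact (hQ _).2 ⟨-y, by simp⟩
    · rintro ⟨y, hy⟩
      rw [← hy]
      exact map_zero q
  · obtain ⟨x, rfl⟩ := hq n
    exact ⟨Q.mkQ (x, 0), rfl⟩
  · obtain ⟨y, rfl, hy⟩ := (hQ _).1 hx
    rw [(injective_iff_map_eq_zero i).1 hi y (neg_eq_zero.1 hy), map_zero]
  · obtain ⟨⟨x, e⟩, rfl⟩ := Q.mkQ_surjective z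
    constructor
    · intro h
      obtain ⟨y, rfl⟩ := (Submodule.Quotient.mk_eq_zero _).1 h
      refine ⟨x + k y, ?_⟩
      rw [LinearMap.comp_apply, ← sub_eq_zero, ← map_sub]
      exact (hQ _).2 ⟨y, by simp⟩
    · rintro ⟨y, hy⟩
      rw [← hy]
      exact map_zero I.mkQ
  · obtain ⟨e, rfl⟩ := I.mkQ_surjective e
    exact ⟨Q.mkQ (0, e), rfl⟩

theorem exists_special_precover (hR : PassesTests t R) (hext : ClosedUnderExtensions t)
    (N : ModuleCat.{u} R) : ∃ (E F : ModuleCat.{u} R) (i : E →ₗ[R] F) (p : F →ₗ[R] N),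
      Function.Injective i ∧ Function.Exact i p ∧ Function.Surjective p ∧ IsOrthogonal t E ∧
      PassesTests t F := by
  let q : (N →₀ R) →ₗ[R] N := Finsupp.linearCombination R id
  have hq : Function.Surjective q := Finsupp.linearCombination_id_surjective R N
  obtain ⟨B, hB⟩ := exists_testUnder_isOrthogonal hext (.of_projective hR _)
    (ModuleCat.of R (LinearMap.ker q))
  obtain ⟨F, i, p, a, b, hi, hip, hp, ha, hab, hb⟩ := LinearMap.exists_pushout
    (LinearMap.ker q).subtype_injective (LinearMap.exact_subtype_ker_map q) hq B.2.1
  exact ⟨B.1.right, F, i, p, hi, hip, hp, hB, hext _ _ _ a b ha hab hb (.finsupp hR N) B.2.2⟩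

theorem exists_cover (hR : PassesTests t R) (hext : ClosedUnderExtensions t)
    (M : ModuleCat.{u} R) : ∃ (F : ModuleCat.{u} R) (φ : F ⟶ M), PassesTests t F ∧
      (∀ F' : ModuleCat.{u} R, PassesTests t F' → ∀ φ' : F' ⟶ M, ∃ ψ : F' ⟶ F, ψ ≫ φ = φ') ∧
      ∀ f : F ⟶ F, f ≫ φ = φ → IsIso f := by
  obtain ⟨E, F, i, p, hi, hip, hp, hE, hF⟩ := exists_special_precover hR hext M
  let B : (testOver t M).FullSubcategory := ⟨Over.mk (ModuleCat.ofHom p), hF⟩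
  have hw : IsWeaklyTerminal B := fun X ↦ by
    obtain ⟨ψ, hψ⟩ := (hE _ X.2).exists_lift i p hi hip hp X.1.hom.hom
    exact ⟨ObjectProperty.homMk (Over.homMk (ModuleCat.ofHom ψ) (ModuleCat.hom_ext hψ))⟩
  obtain ⟨T, hT, hiso⟩ := hw.exists_isIso ((testOver t M).ι ⋙ Over.forget M)
  refine ⟨T.1.left, T.1.hom, T.2, fun F' hF' φ' ↦ ?_, fun f hf ↦ ?_⟩
  · obtain ⟨g⟩ := hT ⟨Over.mk φ', hF'⟩
    exact ⟨g.hom.left, Over.w g.hom⟩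
  · let f' : T ⟶ T := ObjectProperty.homMk (Over.homMk f hf)
    have := hiso f'
    exact inferInstanceAs (IsIso (((testOver t M).ι ⋙ Over.forget M).map f'))

theorem PassesTests.of_forall_hasExtensions (hR : PassesTests t R)
    (hext : ClosedUnderExtensions t) {M : ModuleCat.{u} R}
    (h : ∀ E : ModuleCat.{u} R, IsOrthogonal t E → HasExtensions R M E) : PassesTests t M := by
  obtain ⟨E, F, i, p, hi, hip, hp, hE, hF⟩ := exists_special_precover hR hext M
  obtain ⟨s, hs⟩ := (h E hE).exists_lift i p hi hip hp LinearMap.id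
  exact hF.of_retract s p hs

end Envelopes

section Syzygies

variable {R : Type u} [CommRing R]

namespace ModuleCat

lemma exists_freeCover (X : ModuleCat.{u} R) : ∃ (G : ModuleCat.{u} R) (p : G →ₗ[R] X),
    Function.Surjective p ∧ Module.Free R G ∧ (Module.Finite R X → Module.Finite R G) := by
  by_cases hX : Module.Finite R X
  · obtain ⟨n, p, hp⟩ := Module.Finite.exists_fin' R X
    exact ⟨of R (ULift.{u} (Fin n) →₀ R),
      p ∘ₗ (Finsupp.linearEquivFunOnFinite R R (Fin n)).toLinearMap ∘ₗ
        (Finsupp.domLCongr Equiv.ulift).toLinearMap, by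
        simpa using hp, inferInstance, fun _ ↦ inferInstance⟩
  · exact ⟨of R (X →₀ R), Finsupp.linearCombination R id,
      Finsupp.linearCombination_id_surjective R X, inferInstance, fun h ↦ (hX h).elim⟩

/-- A free module surjecting onto `X`, which is finitely generated if `X` is. -/
noncomputable def freeCover (X : ModuleCat.{u} R) : ModuleCat.{u} R := X.exists_freeCover.choose

/-- The surjection from the free cover. -/
noncomputable def freeCoverπ (X : ModuleCat.{u} R) : X.freeCover →ₗ[R] X :=
  X.exists_freeCover.choose_spec.choose

lemma freeCoverπ_surjective (X : ModuleCat.{u} R) : Function.Surjective X.freeCoverπ :=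
  X.exists_freeCover.choose_spec.choose_spec.1

instance (X : ModuleCat.{u} R) : Module.Free R X.freeCover :=
  X.exists_freeCover.choose_spec.choose_spec.2.1

instance (X : ModuleCat.{u} R) [Module.Finite R X] : Module.Finite R X.freeCover :=
  X.exists_freeCover.choose_spec.choose_spec.2.2 inferInstance

/-- The syzygies of a module. -/
noncomputable def syzygy (X : ModuleCat.{u} R) : ℕ → ModuleCat.{u} R
  | 0 => X
  | n + 1 => of R (LinearMap.ker (X.syzygy n).freeCoverπ)

/-- The inclusion of a syzygy. -/
noncomputable def syzygyι (X : ModuleCat.{u} R) (n : ℕ) :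
    X.syzygy (n + 1) →ₗ[R] (X.syzygy n).freeCover :=
  (LinearMap.ker (X.syzygy n).freeCoverπ).subtype

variable (X : ModuleCat.{u} R)

lemma syzygyι_injective (n : ℕ) : Function.Injective (X.syzygyι n) :=
  Submodule.subtype_injective _

lemma exact_syzygyι (n : ℕ) : Function.Exact (X.syzygyι n) (X.syzygy n).freeCoverπ :=
  LinearMap.exact_subtype_ker_map _

instance finite_syzygy [IsNoetherianRing R] [hX : Module.Finite R X] (n : ℕ) :
    Module.Finite R (X.syzygy n) := by
  induction n with
  | zero => exact hX
  | succ n ih => exact inferInstanceAs (Module.Finite R (LinearMap.ker (X.syzygy n).freeCoverπ))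

/-- The differential of the free resolution. -/
noncomputable def syzygyD (n : ℕ) : (X.syzygy (n + 1)).freeCover →ₗ[R] (X.syzygy n).freeCover :=
  X.syzygyι n ∘ₗ (X.syzygy (n + 1)).freeCoverπ

lemma syzygyD_exact (n : ℕ) : Function.Exact (X.syzygyD (n + 1)) (X.syzygyD n) := by
  intro x
  change X.syzygyι n _ = 0 ↔ _
  rw [map_eq_zero_iff _ (X.syzygyι_injective n)]
  refine (X.exact_syzygyι (n + 1) x).trans ⟨fun ⟨y, hy⟩ ↦ ?_, fun ⟨y, hy⟩ ↦ ⟨_, hy⟩⟩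
  obtain ⟨y, rfl⟩ := freeCoverπ_surjective _ y
  exact ⟨y, hy⟩

lemma exact_syzygyD_freeCoverπ : Function.Exact (X.syzygyD 0) X.freeCoverπ := by
  intro x
  refine (X.exact_syzygyι 0 x).trans ⟨fun ⟨y, hy⟩ ↦ ?_, fun ⟨y, hy⟩ ↦ ⟨_, hy⟩⟩
  obtain ⟨y, rfl⟩ := freeCoverπ_surjective _ y
  exact ⟨y, hy⟩

/-- The complex of free covers of the syzygies of a module. -/
noncomputable def freeComplex : ChainComplex (ModuleCat.{u} R) ℕ :=
  ChainComplex.of (fun n ↦ (X.syzygy n).freeCover) (fun n ↦ ofHom (X.syzygyD n)) fun n ↦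
    hom_ext (X.syzygyD_exact n).linearMap_comp_eq_zero

lemma freeComplex_d (n : ℕ) : X.freeComplex.d (n + 1) n = ofHom (X.syzygyD n) :=
  ChainComplex.of_d (fun n ↦ (X.syzygy n).freeCover) (fun n ↦ ofHom (X.syzygyD n)) n

lemma freeComplex_d_comp :
    X.freeComplex.d 1 0 ≫ (ofHom X.freeCoverπ : X.freeComplex.X 0 ⟶ X) = 0 := by
  rw [freeComplex_d]
  exact hom_ext X.exact_syzygyD_freeCoverπ.linearMap_comp_eq_zero

lemma freeComplex_exactAt (n : ℕ) : X.freeComplex.ExactAt (n + 1) := by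
  rw [HomologicalComplex.exactAt_iff' _ (n + 1 + 1) (n + 1) n (by simp) (by simp),
    ShortComplex.ShortExact.moduleCat_exact_iff_function_exact]
  change Function.Exact (X.freeComplex.d (n + 1 + 1) (n + 1)) (X.freeComplex.d (n + 1) n)
  rw [freeComplex_d, freeComplex_d]
  exact X.syzygyD_exact n

/-- The free resolution of a module. -/
noncomputable def freeResolution : ProjectiveResolution X where
  complex := X.freeComplex
  projective n := by
    have : Module.Projective R (X.syzygy n).freeCover := .of_free
    exact (IsProjective.iff_projective (R := R) (X.syzygy n).freeCover).1 this
  π := (ChainComplex.toSingle₀Equiv _ _).symm ⟨ofHom X.freeCoverπ, X.freeComplex_d_comp⟩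
  quasiIso := ⟨fun n ↦ by
    cases n
    · rw [ChainComplex.quasiIsoAt₀_iff, ShortComplex.quasiIso_iff_of_zeros']
      · refine (ShortComplex.exact_and_epi_g_iff_of_iso (S₂ := ShortComplex.mk
          (ofHom (X.syzygyD 0)) (ofHom X.freeCoverπ)
          (hom_ext X.exact_syzygyD_freeCoverπ.linearMap_comp_eq_zero)) ?_).2 ⟨?_, ?_⟩
        · exact ShortComplex.isoMk (Iso.refl _) (Iso.refl _) (Iso.refl _)
            ((Category.id_comp _).trans ((X.freeComplex_d 0).symm.trans (Category.comp_id _).symm))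
            ((Category.id_comp _).trans (((ChainComplex.toSingle₀Equiv_symm_apply_f_zero
              (C := X.freeComplex) (X := X) (ofHom X.freeCoverπ) X.freeComplex_d_comp).symm).trans
              (Category.comp_id _).symm))
        · rw [ShortComplex.ShortExact.moduleCat_exact_iff_function_exact]
          exact X.exact_syzygyD_freeCoverπ
        · exact (epi_iff_surjective _).2 X.freeCoverπ_surjective
      all_goals rfl
    · rw [quasiIsoAt_iff_exactAt']
      · apply freeComplex_exactAt
      · apply ChainComplex.exactAt_succ_single_obj⟩

end ModuleCat

end Syzygies

section Translation

open MonoidalCategory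

variable {R : Type u} [CommRing R]

lemma LinearMap.exact_comp_comp_iff_injective {G₂ S₂ G₁ S₁ G₀ : Type*} [AddCommGroup G₂]
    [Module R G₂] [AddCommGroup S₂] [Module R S₂] [AddCommGroup G₁] [Module R G₁] [AddCommGroup S₁]
    [Module R S₁]
    [AddCommGroup G₀] [Module R G₀] (p₂ : G₂ →ₗ[R] S₂) (i₁ : S₂ →ₗ[R] G₁) (p₁ : G₁ →ₗ[R] S₁)
    (i₀ : S₁ →ₗ[R] G₀) (hp₂ : Function.Surjective p₂) (hip : Function.Exact i₁ p₁)
    (hp₁ : Function.Surjective p₁) :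
    Function.Exact (i₁ ∘ₗ p₂) (i₀ ∘ₗ p₁) ↔ Function.Injective i₀ := by
  constructor
  · refine fun h ↦ (injective_iff_map_eq_zero i₀).2 fun z hz ↦ ?_
    obtain ⟨y, rfl⟩ := hp₁ z
    obtain ⟨w, rfl⟩ := (h y).1 hz
    exact hip.apply_apply_eq_zero (p₂ w)
  · intro h y
    rw [LinearMap.comp_apply, map_eq_zero_iff i₀ h, hip y]
    refine ⟨fun ⟨w, hw⟩ ↦ ?_, fun ⟨w, hw⟩ ↦ ⟨_, hw⟩⟩
    obtain ⟨w, rfl⟩ := hp₂ w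
    exact ⟨w, hw⟩

namespace ModuleCat

variable (X : ModuleCat.{u} R)

lemma exact_lTensor_syzygyD_iff (A : ModuleCat.{u} R) (n : ℕ) :
    Function.Exact ((X.syzygyD (n + 1)).lTensor A) ((X.syzygyD n).lTensor A) ↔
      Function.Injective ((X.syzygyι n).lTensor A) := by
  rw [syzygyD, syzygyD, LinearMap.lTensor_comp, LinearMap.lTensor_comp]
  exact LinearMap.exact_comp_comp_iff_injective _ _ _ _
    (LinearMap.lTensor_surjective A (freeCoverπ_surjective _))
    (lTensor_exact A (X.exact_syzygyι (n + 1)) (freeCoverπ_surjective _))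
    (LinearMap.lTensor_surjective A (freeCoverπ_surjective _))

lemma exact_rTensor_syzygyD_iff (M : Type u) [AddCommGroup M] [Module R M] (n : ℕ) :
    Function.Exact ((X.syzygyD (n + 1)).rTensor M) ((X.syzygyD n).rTensor M) ↔
      Function.Injective ((X.syzygyι n).rTensor M) := by
  rw [syzygyD, syzygyD, LinearMap.rTensor_comp, LinearMap.rTensor_comp]
  exact LinearMap.exact_comp_comp_iff_injective _ _ _ _
    (LinearMap.rTensor_surjective M (freeCoverπ_surjective _))
    (rTensor_exact M (X.exact_syzygyι (n + 1)) (freeCoverπ_surjective _))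
    (LinearMap.rTensor_surjective M (freeCoverπ_surjective _))

lemma torVanishes_succ_iff (A : ModuleCat.{u} R) (n : ℕ) :
    torVanishes R A X (n + 1) ↔ Function.Injective ((X.syzygyι n).lTensor A) := by
  rw [← exact_lTensor_syzygyD_iff]
  have e := X.freeResolution.isoLeftDerivedObj ((tensoringLeft (ModuleCat.{u} R)).obj A) (n + 1)
  have h₁ : torVanishes R A X (n + 1) ↔
      IsZero (((((tensoringLeft (ModuleCat.{u} R)).obj A).mapHomologicalComplex _).obj
        X.freeComplex).homology (n + 1)) :=
    ModuleCat.isZero_iff_subsingleton.symm.trans e.isZero_iff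
  rw [h₁, ← HomologicalComplex.exactAt_iff_isZero_homology,
    HomologicalComplex.exactAt_iff' _ (n + 1 + 1) (n + 1) n (by simp) (by simp),
    ShortComplex.ShortExact.moduleCat_exact_iff_function_exact]
  change Function.Exact (A ◁ X.freeComplex.d (n + 1 + 1) (n + 1))
    (A ◁ X.freeComplex.d (n + 1) n) ↔ _
  rw [freeComplex_d, freeComplex_d]
  rfl

lemma hasExtensions_syzygy_iff (N : Type u) [AddCommGroup N] [Module R N] (n : ℕ) :
    HasExtensions R (X.syzygy n) N ↔ ∀ φ : (X.syzygy (n + 1)).freeCover →ₗ[R] N,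
      φ ∘ₗ X.syzygyD (n + 1) = 0 → ∃ ψ : (X.syzygy n).freeCover →ₗ[R] N,
        ψ ∘ₗ X.syzygyD n = φ := by
  constructor
  · intro h φ hφ
    obtain ⟨g, hg⟩ := LinearMap.exists_comp_eq_of_surjective _
      (X.syzygy (n + 1)).freeCoverπ_surjective φ fun m hm ↦ by
        obtain ⟨k, rfl⟩ := (X.exact_syzygyι (n + 1) m).1 hm
        obtain ⟨y, rfl⟩ := freeCoverπ_surjective _ k
        exact LinearMap.congr_fun hφ y
    obtain ⟨ψ, hψ⟩ := h _ _ _ _ (X.syzygyι_injective n) (X.exact_syzygyι n)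
      (freeCoverπ_surjective _) g
    exact ⟨ψ, by rw [syzygyD, ← LinearMap.comp_assoc, hψ, hg]⟩
  · intro h
    have : Module.Projective R (X.syzygy n).freeCover := .of_free
    refine .of_projective _ (freeCoverπ_surjective _) fun f ↦ ?_
    obtain ⟨ψ, hψ⟩ := h ((show X.syzygy (n + 1) →ₗ[R] N from f) ∘ₗ
      (X.syzygy (n + 1)).freeCoverπ) (LinearMap.ext fun x ↦
        (congrArg f ((X.exact_syzygyι (n + 1)).apply_apply_eq_zero _)).trans (map_zero f))
    refine ⟨ψ, LinearMap.ext fun k ↦ ?_⟩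
    obtain ⟨y, rfl⟩ := (X.syzygy (n + 1)).freeCoverπ_surjective k
    exact LinearMap.congr_fun hψ y

lemma extVanishes_succ_iff (N : ModuleCat.{u} R) (n : ℕ) :
    extVanishes R X N (n + 1) ↔ HasExtensions R (X.syzygy n) N := by
  rw [hasExtensions_syzygy_iff]
  have e := X.freeResolution.isoExt (R := R) (n + 1) N
  have h₁ : extVanishes R X N (n + 1) ↔
      IsZero ((X.freeComplex.linearYonedaObj R N).homology (n + 1)) :=
    ModuleCat.isZero_iff_subsingleton.symm.trans e.isZero_iff
  rw [h₁, ← HomologicalComplex.exactAt_iff_isZero_homology,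
    HomologicalComplex.exactAt_iff' _ n (n + 1) (n + 1 + 1) (by simp) (by simp),
    ShortComplex.ShortExact.moduleCat_exact_iff_function_exact]
  change Function.Exact (fun φ : X.freeComplex.X n ⟶ N ↦ X.freeComplex.d (n + 1) n ≫ φ)
    (fun φ : X.freeComplex.X (n + 1) ⟶ N ↦ X.freeComplex.d (n + 1 + 1) (n + 1) ≫ φ) ↔ _
  rw [freeComplex_d, freeComplex_d]
  constructor
  · intro h φ hφ
    obtain ⟨ψ, hψ⟩ := (h (ofHom φ)).1 (hom_ext hφ)
    exact ⟨ψ.hom, congrArg Hom.hom hψ⟩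
  · refine fun h φ ↦ ⟨fun hφ ↦ ?_, ?_⟩
    · obtain ⟨ψ, hψ⟩ := h φ.hom (congrArg Hom.hom hφ)
      exact ⟨ofHom ψ, hom_ext hψ⟩
    · rintro ⟨ψ, rfl⟩
      ext x
      exact (congrArg ψ.hom ((X.syzygyD_exact n).apply_apply_eq_zero x)).trans (map_zero ψ.hom)

end ModuleCat

end Translation

section Balancing

variable {R : Type u} [CommRing R] {Y' G Y Z' P Z : Type u} [AddCommGroup Y'] [Module R Y']
  [AddCommGroup G] [Module R G] [AddCommGroup Y] [Module R Y] [AddCommGroup Z'] [Module R Z']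
  [AddCommGroup P] [Module R P] [AddCommGroup Z] [Module R Z]

lemma LinearMap.lTensor_injective_of_rTensor_injective [Module.Flat R G] {i : Y' →ₗ[R] G}
    {p : G →ₗ[R] Y} (hip : Function.Exact i p) (hp : Function.Surjective p) {j : Z' →ₗ[R] P}
    {q : P →ₗ[R] Z} (hj : Function.Injective j) (hjq : Function.Exact j q)
    (hq : Function.Surjective q) (h : Function.Injective (i.rTensor Z)) :
    Function.Injective (j.lTensor Y) := by
  refine (injective_iff_map_eq_zero _).2 fun y hy ↦ ?_
  obtain ⟨g, rfl⟩ := LinearMap.rTensor_surjective Z' hp y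
  rw [← LinearMap.rTensor_lTensor_apply] at hy
  obtain ⟨w, hw⟩ := (rTensor_exact P hip hp _).1 hy
  have hqw : q.lTensor Y' w = 0 := by
    apply h
    rw [LinearMap.rTensor_lTensor_apply, hw, map_zero]
    exact (lTensor_exact G hjq hq).apply_apply_eq_zero g
  obtain ⟨v, rfl⟩ := (lTensor_exact Y' hjq hq _).1 hqw
  rw [LinearMap.rTensor_lTensor_apply] at hw
  rw [← Module.Flat.lTensor_preserves_injective_linearMap (M := G) j hj hw]
  exact (rTensor_exact Z' hip hp).apply_apply_eq_zero v

lemma LinearMap.lTensor_injective_iff_rTensor_injective [Module.Flat R G] [Module.Flat R P]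
    {i : Y' →ₗ[R] G} {p : G →ₗ[R] Y} (hi : Function.Injective i) (hip : Function.Exact i p)
    (hp : Function.Surjective p) {j : Z' →ₗ[R] P} {q : P →ₗ[R] Z} (hj : Function.Injective j)
    (hjq : Function.Exact j q) (hq : Function.Surjective q) :
    Function.Injective (j.lTensor Y) ↔ Function.Injective (i.rTensor Z) := by
  refine ⟨fun h ↦ ?_, LinearMap.lTensor_injective_of_rTensor_injective hip hp hj hjq hq⟩
  rw [← LinearMap.lTensor_inj_iff_rTensor_inj]
  rw [LinearMap.lTensor_inj_iff_rTensor_inj] at h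
  exact LinearMap.lTensor_injective_of_rTensor_injective hjq hq hi hip hp h

lemma LinearMap.lTensor_injective_iff_rTensor_injective_of_flat [Module.Flat R G]
    [Module.Flat R P] {i : Y' →ₗ[R] G} (hi : Function.Injective i) {j : Z' →ₗ[R] P}
    (hj : Function.Injective j) :
    Function.Injective (j.lTensor Y') ↔ Function.Injective (i.rTensor Z') := by
  have h₁ := Module.Flat.lTensor_preserves_injective_linearMap (M := G) j hj
  have h₂ := Module.Flat.rTensor_preserves_injective_linearMap (M := P) i hi
  rw [← h₁.of_comp_iff, ← h₂.of_comp_iff, ← LinearMap.coe_comp, ← LinearMap.coe_comp,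
    LinearMap.rTensor_comp_lTensor, LinearMap.lTensor_comp_rTensor]

namespace ModuleCat

lemma lTensor_syzygyι_injective_iff_succ (X M : ModuleCat.{u} R) (m n : ℕ) :
    Function.Injective ((M.syzygyι n).lTensor (X.syzygy (m + 1))) ↔
      Function.Injective ((M.syzygyι (n + 1)).lTensor (X.syzygy m)) := by
  rw [LinearMap.lTensor_injective_iff_rTensor_injective_of_flat (X.syzygyι_injective m)
    (M.syzygyι_injective n), LinearMap.lTensor_injective_iff_rTensor_injective
    (X.syzygyι_injective m) (X.exact_syzygyι m) (freeCoverπ_surjective _)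
    (M.syzygyι_injective (n + 1)) (M.exact_syzygyι (n + 1)) (freeCoverπ_surjective _)]

lemma lTensor_syzygyι_injective_iff (X M : ModuleCat.{u} R) (n : ℕ) :
    Function.Injective ((M.syzygyι n).lTensor X) ↔
      Function.Injective ((X.syzygyι n).rTensor M) := by
  have key (m k l : ℕ) (h : k + m = l) :
      Function.Injective ((M.syzygyι k).lTensor (X.syzygy m)) ↔
        Function.Injective ((M.syzygyι l).lTensor X) := by
    induction m generalizing k with
    | zero => subst h; rfl
    | succ m ih => rw [lTensor_syzygyι_injective_iff_succ, ih (k + 1) (by omega)]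
  rw [← key n 0 n n.zero_add]
  exact LinearMap.lTensor_injective_iff_rTensor_injective
    (X.syzygyι_injective n) (X.exact_syzygyι n) (freeCoverπ_surjective _)
    (M.syzygyι_injective 0) (M.exact_syzygyι 0) (freeCoverπ_surjective _)

end ModuleCat

end Balancing

section HomTensor

variable {R : Type u} [CommRing R]

lemma rTensorHomEquivHomRTensor_rTensor_lcomp {G G' : Type u} [AddCommGroup G] [Module R G]
    [AddCommGroup G'] [Module R G'] [Module.Projective R G] [Module.Finite R G]
    [Module.Projective R G'] [Module.Finite R G'] (V M : Type u) [AddCommGroup V] [Module R V]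
    [AddCommGroup M] [Module R M] (d : G' →ₗ[R] G) (x : (G →ₗ[R] V) ⊗[R] M) :
    rTensorHomEquivHomRTensor R G' V M ((LinearMap.lcomp R V d).rTensor M x) =
      rTensorHomEquivHomRTensor R G V M x ∘ₗ d := by
  induction x with
  | zero => simp
  | tmul f m => ext; simp
  | add x y hx hy => rw [map_add, map_add, map_add, hx, hy, LinearMap.add_comp]

lemma rTensorHomEquivHomRTensor_lTensor {G : Type u} [AddCommGroup G] [Module R G]
    [Module.Projective R G] [Module.Finite R G] {V M N : Type u} [AddCommGroup V] [Module R V]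
    [AddCommGroup M] [Module R M] [AddCommGroup N] [Module R N] (f : M →ₗ[R] N)
    (x : (G →ₗ[R] V) ⊗[R] M) :
    rTensorHomEquivHomRTensor R G V N (f.lTensor _ x) =
      f.lTensor V ∘ₗ rTensorHomEquivHomRTensor R G V M x := by
  induction x with
  | zero => simp
  | tmul f m => ext; simp
  | add x y hx hy => rw [map_add, map_add, map_add, hx, hy, LinearMap.comp_add]

lemma LinearMap.lTensor_hom_injective {G : Type u} [AddCommGroup G] [Module R G]
    [Module.Projective R G] [Module.Finite R G] {V M N : Type u} [AddCommGroup V] [Module R V]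
    [AddCommGroup M] [Module R M] [AddCommGroup N] [Module R N] (f : M →ₗ[R] N)
    (hf : Function.Injective (f.lTensor V)) :
    Function.Injective (f.lTensor (G →ₗ[R] V)) := by
  refine (injective_iff_map_eq_zero _).2 fun x hx ↦ ?_
  have := rTensorHomEquivHomRTensor_lTensor (V := V) f x
  rw [hx, map_zero] at this
  apply (rTensorHomEquivHomRTensor R G V M).injective
  rw [map_zero]
  ext g
  exact hf ((LinearMap.congr_fun this g).symm.trans (map_zero _).symm)

lemma rTensorHomEquivHomRTensor_rTensor_toSpanSingleton {G : Type u} [AddCommGroup G] [Module R G]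
    [Module.Projective R G] [Module.Finite R G] {V M : Type u} [AddCommGroup V] [Module R V]
    [AddCommGroup M] [Module R M] (π : G →ₗ[R] V) (x : R ⊗[R] M) :
    rTensorHomEquivHomRTensor R G V M ((LinearMap.toSpanSingleton R _ π).rTensor M x) =
      etaMap R V M (TensorProduct.lid R M x) ∘ₗ π := by
  induction x with
  | zero => simp
  | tmul f m => ext; simp [etaMap, TensorProduct.smul_tmul']
  | add x y hx hy => simp only [map_add, hx, hy, LinearMap.add_comp]

end HomTensor

section Auslander

variable {R : Type u} [CommRing R]

lemma ExactnessTest.Holds.of_exact {t : ExactnessTest R} (ht : t.g ∘ₗ t.f = 0) {K M N : Type u}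
    [AddCommGroup K] [Module R K] [AddCommGroup M] [Module R M] [AddCommGroup N] [Module R N]
    {i : K →ₗ[R] M} {p : M →ₗ[R] N} (hip : Function.Exact i p) (hp : Function.Surjective p)
    (hi : Function.Injective (i.lTensor t.D)) (hK : t.Holds K) (hN : t.Holds N) : t.Holds M := by
  intro x hx
  obtain ⟨z, hz⟩ := hN (p.lTensor _ x) (by rw [LinearMap.rTensor_lTensor_apply, hx, map_zero])
  obtain ⟨y, rfl⟩ := LinearMap.lTensor_surjective t.A hp z
  have hy : t.g.rTensor M (t.f.rTensor M y) = 0 := by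
    rw [← LinearMap.comp_apply, ← LinearMap.rTensor_comp, ht, LinearMap.rTensor_zero,
      LinearMap.zero_apply]
  obtain ⟨w, hw⟩ := (lTensor_exact t.B hip hp (x - t.f.rTensor M y)).1 (by
    rw [map_sub, ← hz, LinearMap.rTensor_lTensor_apply, sub_self])
  obtain ⟨v, rfl⟩ := hK w (hi (by
    rw [map_zero, ← LinearMap.rTensor_lTensor_apply, hw, map_sub, hx, hy, sub_zero]))
  refine ⟨y + i.lTensor _ v, ?_⟩
  rw [map_add, LinearMap.rTensor_lTensor_apply, hw, add_sub_cancel]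

namespace ModuleCat

/-- The tests for membership in the Auslander class: the `n`-th test of the first family expresses
the vanishing of `Tor` in degree `n + 1`, the `n`-th test of the second family the vanishing of
`Ext` in degree `n + 1`, and the last two the injectivity and surjectivity of the unit map. -/
noncomputable def auslanderTest (X : ModuleCat.{u} R) : ℕ ⊕ ℕ ⊕ Bool → ExactnessTest R
  | .inl n => ⟨(X.syzygy (n + 2)).freeCover, (X.syzygy (n + 1)).freeCover,
      (X.syzygy n).freeCover, X.syzygyD (n + 1), X.syzygyD n⟩
  | .inr (.inl n) => ⟨of R ((X.syzygy n).freeCover →ₗ[R] X),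
      of R ((X.syzygy (n + 1)).freeCover →ₗ[R] X), of R ((X.syzygy (n + 2)).freeCover →ₗ[R] X),
      LinearMap.lcomp R X (X.syzygyD n), LinearMap.lcomp R X (X.syzygyD (n + 1))⟩
  | .inr (.inr false) => ⟨of R R, of R R, of R ((X.syzygy 0).freeCover →ₗ[R] X), 0,
      LinearMap.toSpanSingleton R _ X.freeCoverπ⟩
  | .inr (.inr true) => ⟨of R R, of R ((X.syzygy 0).freeCover →ₗ[R] X),
      of R ((X.syzygy 1).freeCover →ₗ[R] X), LinearMap.toSpanSingleton R _ X.freeCoverπ,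
      LinearMap.lcomp R X (X.syzygyD 0)⟩

variable (X : ModuleCat.{u} R)

lemma auslanderTest_comp (i : ℕ ⊕ ℕ ⊕ Bool) :
    (X.auslanderTest i).g ∘ₗ (X.auslanderTest i).f = 0 := by
  match i with
  | .inl n => exact (X.syzygyD_exact n).linearMap_comp_eq_zero
  | .inr (.inl n) =>
    refine LinearMap.ext fun (φ : (X.syzygy n).freeCover →ₗ[R] X) ↦ LinearMap.ext fun x ↦ ?_
    exact (congrArg φ ((X.syzygyD_exact n).apply_apply_eq_zero x)).trans (map_zero φ)
  | .inr (.inr false) => exact LinearMap.comp_zero _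
  | .inr (.inr true) =>
    refine LinearMap.ext fun (r : R) ↦ LinearMap.ext fun x ↦ ?_
    exact (congrArg (r • ·) (X.exact_syzygyD_freeCoverπ.apply_apply_eq_zero x)).trans (smul_zero r)

lemma holds_auslanderTest_tor_iff (M : Type u) [AddCommGroup M] [Module R M] (n : ℕ) :
    (X.auslanderTest (.inl n)).Holds M ↔ Function.Injective ((X.syzygyι n).rTensor M) := by
  rw [← exact_rTensor_syzygyD_iff]
  refine ⟨fun h x ↦ ⟨h x, ?_⟩, fun h x ↦ (h x).1⟩
  rintro ⟨y, rfl⟩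
  rw [← LinearMap.comp_apply, ← LinearMap.rTensor_comp,
    (X.syzygyD_exact n).linearMap_comp_eq_zero, LinearMap.rTensor_zero, LinearMap.zero_apply]

lemma etaMap_self_bijective
    (h : Function.Bijective fun r : R ↦ r • (LinearMap.id : X →ₗ[R] X)) :
    Function.Bijective (etaMap R X R) := by
  have key : (etaMap R X R : R → X →ₗ[R] X ⊗[R] R) =
      (LinearEquiv.congrRight (TensorProduct.rid R X).symm) ∘
        fun r : R ↦ r • (LinearMap.id : X →ₗ[R] X) := by
    ext r x
    change x ⊗ₜ[R] r = (TensorProduct.rid R X).symm (r • x)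
    rw [TensorProduct.rid_symm_apply, TensorProduct.smul_tmul, smul_eq_mul, mul_one]
  rw [key]
  exact (LinearEquiv.bijective _).comp h

variable [Module.Finite R X]

lemma holds_auslanderTest_injective_iff (M : Type u) [AddCommGroup M] [Module R M] :
    (X.auslanderTest (.inr (.inr false))).Holds M ↔ Function.Injective (etaMap R X M) := by
  rw [injective_iff_map_eq_zero]
  have key (x : R ⊗[R] M) :
      (LinearMap.toSpanSingleton R _ X.freeCoverπ).rTensor M x = 0 ↔
        etaMap R X M (TensorProduct.lid R M x) = 0 := by
    rw [← (rTensorHomEquivHomRTensor R X.freeCover X M).map_eq_zero_iff,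
      rTensorHomEquivHomRTensor_rTensor_toSpanSingleton, ← LinearMap.zero_comp X.freeCoverπ,
      LinearMap.cancel_right X.freeCoverπ_surjective]
  constructor
  · intro h m hm
    obtain ⟨y, hy⟩ := h ((TensorProduct.lid R M).symm m)
      ((key _).2 (by rwa [LinearEquiv.apply_symm_apply]))
    have hy' : (0 : R ⊗[R] M) = (TensorProduct.lid R M).symm m := by
      refine Eq.trans ?_ hy
      exact (LinearMap.congr_fun (LinearMap.rTensor_zero M) y).symm
    simpa using hy'.symm
  · intro h x hx
    refine ⟨0, (map_zero _).trans ?_⟩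
    have := h _ ((key x).1 hx)
    exact ((TensorProduct.lid R M).map_eq_zero_iff.1 this).symm

variable [IsNoetherianRing R]

lemma holds_auslanderTest_ext_iff (M : Type u) [AddCommGroup M] [Module R M] (n : ℕ) :
    (X.auslanderTest (.inr (.inl n))).Holds M ↔ HasExtensions R (X.syzygy n) (X ⊗[R] M) := by
  change (∀ x : ((X.syzygy (n + 1)).freeCover →ₗ[R] X) ⊗[R] M,
    (LinearMap.lcomp R X (X.syzygyD (n + 1))).rTensor M x = 0 →
      ∃ y : ((X.syzygy n).freeCover →ₗ[R] X) ⊗[R] M,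
        (LinearMap.lcomp R X (X.syzygyD n)).rTensor M y = x) ↔ _
  rw [hasExtensions_syzygy_iff]
  constructor
  · intro h φ hφ
    obtain ⟨x, rfl⟩ := (rTensorHomEquivHomRTensor R (X.syzygy (n + 1)).freeCover X M).surjective φ
    rw [← rTensorHomEquivHomRTensor_rTensor_lcomp, LinearEquiv.map_eq_zero_iff] at hφ
    obtain ⟨y, hy⟩ := h x hφ
    refine ⟨rTensorHomEquivHomRTensor R _ X M y, ?_⟩
    rw [← rTensorHomEquivHomRTensor_rTensor_lcomp]
    exact congrArg _ hy
  · intro h x hx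
    obtain ⟨ψ, hψ⟩ := h (rTensorHomEquivHomRTensor R (X.syzygy (n + 1)).freeCover X M x) (by
      rw [← rTensorHomEquivHomRTensor_rTensor_lcomp, LinearEquiv.map_eq_zero_iff]
      exact hx)
    obtain ⟨y, rfl⟩ := (rTensorHomEquivHomRTensor R (X.syzygy n).freeCover X M).surjective ψ
    rw [← rTensorHomEquivHomRTensor_rTensor_lcomp] at hψ
    exact ⟨y, (rTensorHomEquivHomRTensor R (X.syzygy (n + 1)).freeCover X M).injective hψ⟩

lemma holds_auslanderTest_surjective_iff (M : Type u) [AddCommGroup M] [Module R M] :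
    (X.auslanderTest (.inr (.inr true))).Holds M ↔ Function.Surjective (etaMap R X M) := by
  change (∀ x : (X.freeCover →ₗ[R] X) ⊗[R] M,
    (LinearMap.lcomp R X (X.syzygyD 0)).rTensor M x = 0 → ∃ y : R ⊗[R] M,
      (LinearMap.toSpanSingleton R _ X.freeCoverπ).rTensor M y = x) ↔ _
  constructor
  · intro h φ
    obtain ⟨x, hx⟩ := (rTensorHomEquivHomRTensor R X.freeCover X M).surjective
      (φ ∘ₗ X.freeCoverπ)
    obtain ⟨y, hy⟩ := h x (by
      apply (rTensorHomEquivHomRTensor R (X.syzygy 1).freeCover X M).injective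
      refine (rTensorHomEquivHomRTensor_rTensor_lcomp X M (X.syzygyD 0) x).trans ?_
      refine (congrArg (· ∘ₗ X.syzygyD 0) hx).trans (Eq.trans ?_ (map_zero _).symm)
      ext z
      exact (congrArg φ (X.exact_syzygyD_freeCoverπ.apply_apply_eq_zero z)).trans (map_zero φ))
    refine ⟨TensorProduct.lid R M y, (LinearMap.cancel_right X.freeCoverπ_surjective).1 ?_⟩
    rw [← rTensorHomEquivHomRTensor_rTensor_toSpanSingleton, ← hx]
    exact congrArg _ hy
  · intro h x hx
    obtain ⟨φ, hφ⟩ := LinearMap.exists_comp_eq_of_surjective _ X.freeCoverπ_surjective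
      (rTensorHomEquivHomRTensor R X.freeCover X M x) fun m hm ↦ by
        obtain ⟨z, rfl⟩ := (X.exact_syzygyD_freeCoverπ m).1 hm
        have := rTensorHomEquivHomRTensor_rTensor_lcomp X M (X.syzygyD 0) x
        refine (LinearMap.congr_fun this z).symm.trans ?_
        exact LinearMap.congr_fun ((congrArg _ hx).trans (map_zero _)) z
    obtain ⟨m, rfl⟩ := h φ
    refine ⟨(TensorProduct.lid R M).symm m,
      (rTensorHomEquivHomRTensor R X.freeCover X M).injective ?_⟩
    refine (rTensorHomEquivHomRTensor_rTensor_toSpanSingleton _ _).trans ?_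
    rw [LinearEquiv.apply_symm_apply, hφ]

lemma memAuslander_iff_passesTests (M : ModuleCat.{u} R) :
    memAuslander R X M ↔ PassesTests X.auslanderTest M := by
  have h₁ (n : ℕ) : torVanishes R X M (n + 1) ↔ (X.auslanderTest (.inl n)).Holds M := by
    rw [torVanishes_succ_iff, lTensor_syzygyι_injective_iff, holds_auslanderTest_tor_iff]
  have h₂ (n : ℕ) : extVanishes R X (of R (X ⊗[R] M)) (n + 1) ↔
      (X.auslanderTest (.inr (.inl n))).Holds M := by
    rw [extVanishes_succ_iff, holds_auslanderTest_ext_iff]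
  have h₃ := X.holds_auslanderTest_injective_iff M
  have h₄ := X.holds_auslanderTest_surjective_iff M
  constructor
  · rintro ⟨htor, hext, hη⟩ (n | n | b)
    · exact (h₁ n).1 (htor _ n.succ_pos)
    · exact (h₂ n).1 (hext _ n.succ_pos)
    · cases b
      · exact h₃.2 hη.1
      · exact h₄.2 hη.2
  · refine fun h ↦ ⟨fun j hj ↦ ?_, fun j hj ↦ ?_, h₃.1 (h _), h₄.1 (h _)⟩
    · obtain ⟨n, rfl⟩ := Nat.exists_eq_succ_of_ne_zero hj.ne'
      exact (h₁ n).2 (h _)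
    · obtain ⟨n, rfl⟩ := Nat.exists_eq_succ_of_ne_zero hj.ne'
      exact (h₂ n).2 (h _)

lemma closedUnderExtensions_auslanderTest : ClosedUnderExtensions X.auslanderTest := by
  intro K M N _ _ _ _ _ _ i p hi hip hp hK hN j
  have hX : Function.Injective (i.lTensor X) :=
    LinearMap.lTensor_injective_of_rTensor_injective (X.exact_syzygyι 0) X.freeCoverπ_surjective
      hi hip hp ((X.holds_auslanderTest_tor_iff N 0).1 (hN _))
  refine .of_exact (X.auslanderTest_comp j) hip hp ?_ (hK j) (hN j)
  match j with
  | .inl n =>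
    exact Module.Flat.lTensor_preserves_injective_linearMap (M := (X.syzygy n).freeCover) i hi
  | .inr (.inl n) =>
    exact LinearMap.lTensor_hom_injective (G := (X.syzygy (n + 2)).freeCover) i hX
  | .inr (.inr false) =>
    exact LinearMap.lTensor_hom_injective (G := (X.syzygy 0).freeCover) i hX
  | .inr (.inr true) =>
    exact LinearMap.lTensor_hom_injective (G := (X.syzygy 1).freeCover) i hX

lemma passesTests_auslanderTest_self
    (hext : ∀ j : ℕ, 0 < j → extVanishes R X X j)
    (h : Function.Bijective fun r : R ↦ r • (LinearMap.id : X →ₗ[R] X)) :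
    PassesTests X.auslanderTest R
  | .inl n => (X.holds_auslanderTest_tor_iff R n).2
      (Module.Flat.rTensor_preserves_injective_linearMap _ (X.syzygyι_injective n))
  | .inr (.inl n) => (X.holds_auslanderTest_ext_iff R n).2
      (((X.extVanishes_succ_iff X n).1 (hext _ n.succ_pos)).of_retract
        (TensorProduct.rid R X).toLinearMap (TensorProduct.rid R X).symm.toLinearMap (by simp))
  | .inr (.inr false) => (X.holds_auslanderTest_injective_iff R).2 (X.etaMap_self_bijective h).1
  | .inr (.inr true) => (X.holds_auslanderTest_surjective_iff R).2 (X.etaMap_self_bijective h).2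

end ModuleCat

end Auslander

end

/-- **Theorem A** (first part): if `C` is a semidualizing module over a commutative
noetherian ring `R`, then `(A_C, (A_C)^⊥)` is a perfect cotorsion pair: it is a cotorsion
pair, every `R`-module has an `A_C`-cover, and every `R`-module has an
`(A_C)^⊥`-envelope. -/
theorem auslanderClass_perfect_cotorsion_pair
    (R : Type u) [CommRing R] [IsNoetherianRing R]
    (C : Type u) [AddCommGroup C] [Module R C] (hC : IsSemidualizing R C) :
    IsPerfectCotorsionPair R (auslanderClass R C) (rightPerp R (auslanderClass R C)) := by
  obtain ⟨hfin, hext, hχ⟩ := hC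
  have hR := (ModuleCat.of R C).passesTests_auslanderTest_self hext hχ
  have hcl := (ModuleCat.of R C).closedUnderExtensions_auslanderTest
  have hmem (M : ModuleCat.{u} R) : M ∈ auslanderClass R C ↔
      PassesTests (ModuleCat.of R C).auslanderTest M :=
    (ModuleCat.of R C).memAuslander_iff_passesTests M
  have hperp (E : ModuleCat.{u} R) : E ∈ rightPerp R (auslanderClass R C) ↔
      IsOrthogonal (ModuleCat.of R C).auslanderTest E :=
    ⟨fun h X _ _ hX ↦ ((ModuleCat.of R X).extVanishes_succ_iff E 0).1 (h _ ((hmem (.of R X)).2 hX)),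
      fun h F hF ↦ (F.extVanishes_succ_iff E 0).2 (h F ((hmem F).1 hF))⟩
  refine ⟨⟨rfl, Set.Subset.antisymm (fun M hM ↦ (hmem M).2 ?_) fun M hM G hG ↦ hG M hM⟩, fun M ↦ ?_,
    fun M ↦ ?_⟩
  · exact PassesTests.of_forall_hasExtensions hR hcl fun E hE ↦
      (M.extVanishes_succ_iff E 0).1 (hM E ((hperp E).2 hE))
  · obtain ⟨F, φ, hF, hφ, hiso⟩ := exists_cover hR hcl M
    exact ⟨F, φ, ⟨(hmem F).2 hF, fun F' hF' ↦ hφ F' ((hmem F').1 hF')⟩, hiso⟩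
  · obtain ⟨E, φ, hE, hφ, hiso⟩ := exists_orthogonal_envelope hR hcl M
    exact ⟨E, φ, ⟨(hperp E).2 hE, fun E' hE' ↦ hφ E' ((hperp E').1 hE')⟩, hiso⟩
end

section
/- Let C be a semidualizing module over a commutative noetherian ring R. Then the Auslander class A_C is preenveloping: every R-module has an A_C-preenvelope. -/
/-!
Common definitions: Ext/Tor vanishing, semidualizing modules, the Auslander and Bass
classes, (pre)covers and (pre)envelopes, cotorsion pairs, the classes `I_C` and `F_C`,
purity, and Kaplansky classes.
-/

open CategoryTheory

universe u

section Homology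

variable {R : Type u} [CommRing R]

lemma extVanishes_succ_iff_of_projectiveResolution {A : ModuleCat.{u} R}
    (P : ProjectiveResolution A) (B : ModuleCat.{u} R) (n : ℕ) :
    extVanishes R A B (n + 1) ↔ ∀ f : P.complex.X (n + 1) ⟶ B,
      P.complex.d (n + 2) (n + 1) ≫ f = 0 → ∃ g : P.complex.X n ⟶ B,
        P.complex.d (n + 1) n ≫ g = f := by
  have h1 : extVanishes R A B (n + 1) ↔
      (P.complex.linearYonedaObj R B).ExactAt (n + 1) := by
    rw [extVanishes, ← ModuleCat.isZero_iff_subsingleton,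
      HomologicalComplex.exactAt_iff_isZero_homology]
    exact (P.isoExt (n + 1) B).isZero_iff
  rw [h1, HomologicalComplex.exactAt_iff' _ n (n + 1) (n + 2) (by simp) (by simp),
    ShortComplex.moduleCat_exact_iff]
  rfl

lemma extVanishes_succ_iff_subsingleton_ext (A B : ModuleCat.{u} R) (n : ℕ) :
    extVanishes R A B (n + 1) ↔ Subsingleton (Abelian.Ext A B (n + 1)) := by
  let P := projectiveResolution A
  rw [extVanishes_succ_iff_of_projectiveResolution P, subsingleton_iff_forall_eq 0]
  constructor
  · intro h α
    obtain ⟨f, hf, rfl⟩ := P.extMk_surjective α (n + 2) rfl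
    exact (P.extMk_eq_zero_iff f _ rfl hf n rfl).2 (h f hf)
  · intro h f hf
    exact (P.extMk_eq_zero_iff f _ rfl hf n rfl).1 (h _)

lemma torVanishes_succ_iff_of_projectiveResolution (A : ModuleCat.{u} R) {B : ModuleCat.{u} R}
    (P : ProjectiveResolution B) (n : ℕ) :
    torVanishes R A B (n + 1) ↔
      Function.Exact ((P.complex.d (n + 2) (n + 1)).hom.lTensor A)
        ((P.complex.d (n + 1) n).hom.lTensor A) := by
  have h1 : torVanishes R A B (n + 1) ↔
      ((((MonoidalCategory.tensoringLeft (ModuleCat.{u} R)).obj A).mapHomologicalComplex _).obj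
        P.complex).ExactAt (n + 1) := by
    rw [torVanishes, ← ModuleCat.isZero_iff_subsingleton,
      HomologicalComplex.exactAt_iff_isZero_homology]
    exact (P.isoLeftDerivedObj
      ((MonoidalCategory.tensoringLeft (ModuleCat.{u} R)).obj A) (n + 1)).isZero_iff
  rw [h1, HomologicalComplex.exactAt_iff' _ (n + 2) (n + 1) n (by simp) (by simp),
    ShortComplex.ShortExact.moduleCat_exact_iff_function_exact]
  rfl

end Homology

section DimensionShifting

variable {R : Type u} [CommRing R]

/-- Diagram chase on three columns `Lᵢ → Fᵢ → Cᵢ`, short exact in the first two spots, with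
exact rows `F₃ → F₂ → F₁ → F₀`. -/
lemma exact_iff_of_exact_rows
    {L₂ L₁ L₀ F₃ F₂ F₁ F₀ C₃ C₂ C₁ : Type*}
    [AddCommGroup L₂] [AddCommGroup L₁] [AddCommGroup L₀]
    [AddCommGroup F₃] [AddCommGroup F₂] [AddCommGroup F₁] [AddCommGroup F₀]
    [AddCommGroup C₃] [AddCommGroup C₂] [AddCommGroup C₁]
    [Module R L₂] [Module R L₁] [Module R L₀]
    [Module R F₃] [Module R F₂] [Module R F₁] [Module R F₀]
    [Module R C₃] [Module R C₂] [Module R C₁]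
    {l₁ : L₂ →ₗ[R] L₁} {l₀ : L₁ →ₗ[R] L₀}
    {d₂ : F₃ →ₗ[R] F₂} {d₁ : F₂ →ₗ[R] F₁} {d₀ : F₁ →ₗ[R] F₀}
    {c₂ : C₃ →ₗ[R] C₂} {c₁ : C₂ →ₗ[R] C₁}
    {i₂ : L₂ →ₗ[R] F₂} {i₁ : L₁ →ₗ[R] F₁} {i₀ : L₀ →ₗ[R] F₀}
    {p₃ : F₃ →ₗ[R] C₃} {p₂ : F₂ →ₗ[R] C₂} {p₁ : F₁ →ₗ[R] C₁}
    (hi₁ : Function.Injective i₁)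
    (hip₂ : Function.Exact i₂ p₂) (hip₁ : Function.Exact i₁ p₁)
    (hp₃ : Function.Surjective p₃) (hp₂ : Function.Surjective p₂)
    (hd₁ : Function.Exact d₂ d₁) (hd₀ : Function.Exact d₁ d₀)
    (hl₁ : ∀ x, i₁ (l₁ x) = d₁ (i₂ x)) (hl₀ : ∀ x, i₀ (l₀ x) = d₀ (i₁ x))
    (hc₂ : ∀ x, p₂ (d₂ x) = c₂ (p₃ x)) (hc₁ : ∀ x, p₁ (d₁ x) = c₁ (p₂ x)) :
    Function.Exact c₂ c₁ ↔ ∀ x, i₀ (l₀ x) = 0 → ∃ y, l₁ y = x := by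
  constructor
  · intro h l hl
    obtain ⟨x, hx⟩ := (hd₀ (i₁ l)).1 (by rw [← hl₀, hl])
    obtain ⟨c, hc⟩ := (h (p₂ x)).1 (by rw [← hc₁, hx, hip₁.apply_apply_eq_zero])
    obtain ⟨y, rfl⟩ := hp₃ c
    obtain ⟨l', hl'⟩ := (hip₂ (x - d₂ y)).1 (by rw [map_sub, hc₂, hc, sub_self])
    exact ⟨l', hi₁ (by rw [hl₁, hl', map_sub, hd₁.apply_apply_eq_zero, sub_zero, hx])⟩
  · refine fun h c ↦ ⟨fun hc ↦ ?_, ?_⟩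
    · obtain ⟨x, rfl⟩ := hp₂ c
      obtain ⟨l, hl⟩ := (hip₁ (d₁ x)).1 (by rw [hc₁, hc])
      obtain ⟨l', rfl⟩ := h l (by rw [hl₀, hl, hd₀.apply_apply_eq_zero])
      obtain ⟨y, hy⟩ := (hd₁ (x - i₂ l')).1 (by rw [map_sub, ← hl₁, hl, sub_self])
      exact ⟨p₃ y, by rw [← hc₂, hy, map_sub, hip₂.apply_apply_eq_zero, sub_zero]⟩
    · rintro ⟨c, rfl⟩
      obtain ⟨y, rfl⟩ := hp₃ c
      rw [← hc₂, ← hc₁, hd₁.apply_apply_eq_zero, map_zero]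

variable {L F C : Type u} [AddCommGroup L] [AddCommGroup F] [AddCommGroup C]
  [Module R L] [Module R F] [Module R C] {i : L →ₗ[R] F} {p : F →ₗ[R] C}

lemma rTensor_lTensor_comm {A B M N : Type*} [AddCommGroup A] [AddCommGroup B] [AddCommGroup M]
    [AddCommGroup N] [Module R A] [Module R B] [Module R M] [Module R N]
    (f : A →ₗ[R] B) (g : M →ₗ[R] N) (x : TensorProduct R A M) :
    f.rTensor N (g.lTensor A x) = g.lTensor B (f.rTensor M x) := by
  rw [← LinearMap.comp_apply, ← LinearMap.comp_apply, LinearMap.rTensor_comp_lTensor,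
    LinearMap.lTensor_comp_rTensor]

lemma projectiveResolution_function_exact {M : ModuleCat.{u} R} (P : ProjectiveResolution M)
    (n : ℕ) : Function.Exact (P.complex.d (n + 2) (n + 1)).hom (P.complex.d (n + 1) n).hom :=
  (ShortComplex.ShortExact.moduleCat_exact_iff_function_exact _).1 (P.exact_succ n)

lemma exists_projectiveResolution_augmentation {M : ModuleCat.{u} R}
    (P : ProjectiveResolution M) : ∃ e : P.complex.X 0 →ₗ[R] M, Function.Surjective e ∧
      Function.Exact (P.complex.d 1 0).hom e := by
  refine ⟨(P.π.f 0).hom, (ModuleCat.epi_iff_surjective _).1 inferInstance, ?_⟩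
  exact (ShortComplex.ShortExact.moduleCat_exact_iff_function_exact _).1
    (ShortComplex.exact_of_g_is_cokernel (ShortComplex.mk (P.complex.d 1 0) (P.π.f 0)
      P.complex_d_comp_π_f_zero)
      P.isColimitCokernelCofork)

instance {M : ModuleCat.{u} R} (P : ProjectiveResolution M) (n : ℕ) :
    Module.Flat R (P.complex.X n) :=
  have := (IsProjective.iff_projective (P.complex.X n)).2 (P.projective n)
  inferInstance

lemma torVanishes_succ_succ_iff [Module.Flat R F] (hi : Function.Injective i)
    (hip : Function.Exact i p) (hp : Function.Surjective p) (M : ModuleCat.{u} R) (n : ℕ) :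
    torVanishes R (ModuleCat.of R C) M (n + 2) ↔ torVanishes R (ModuleCat.of R L) M (n + 1) := by
  let P := projectiveResolution M
  have hd := projectiveResolution_function_exact P
  have hi' (k : ℕ) := Module.Flat.rTensor_preserves_injective_linearMap (M := P.complex.X k) i hi
  rw [torVanishes_succ_iff_of_projectiveResolution _ P,
    torVanishes_succ_iff_of_projectiveResolution _ P]
  refine (exact_iff_of_exact_rows (hi' (n + 1)) (rTensor_exact (P.complex.X (n + 2)) hip hp)
    (rTensor_exact (P.complex.X (n + 1)) hip hp) (p.rTensor_surjective _ hp)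
    (p.rTensor_surjective _ hp) (Module.Flat.lTensor_exact F (hd (n + 1)))
    (Module.Flat.lTensor_exact F (hd n)) (rTensor_lTensor_comm i _) (rTensor_lTensor_comm i _)
    (rTensor_lTensor_comm p _) (rTensor_lTensor_comm p _)).trans ⟨fun h x ↦ ⟨fun hx ↦ h x ?_, ?_⟩,
      fun h x hx ↦ (h x).1 (hi' n (hx.trans (map_zero _).symm))⟩
  · rw [hx, map_zero]
  · rintro ⟨y, rfl⟩
    rw [← LinearMap.comp_apply, ← LinearMap.lTensor_comp, (hd n).linearMap_comp_eq_zero,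
      LinearMap.lTensor_zero, LinearMap.zero_apply]

lemma torVanishes_one_iff [Module.Flat R F] (hi : Function.Injective i)
    (hip : Function.Exact i p) (hp : Function.Surjective p) (M : ModuleCat.{u} R) :
    torVanishes R (ModuleCat.of R C) M 1 ↔ Function.Injective (i.rTensor M) := by
  let P := projectiveResolution M
  obtain ⟨e, he, hde⟩ := exists_projectiveResolution_augmentation P
  have hL := lTensor_exact L hde he
  rw [torVanishes_succ_iff_of_projectiveResolution _ P, injective_iff_map_eq_zero]
  refine (exact_iff_of_exact_rows
    (Module.Flat.rTensor_preserves_injective_linearMap (M := P.complex.X 0) i hi)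
    (rTensor_exact (P.complex.X 1) hip hp)
    (rTensor_exact (P.complex.X 0) hip hp) (p.rTensor_surjective _ hp)
    (p.rTensor_surjective _ hp)
    (Module.Flat.lTensor_exact F (projectiveResolution_function_exact P 0))
    (Module.Flat.lTensor_exact F hde) (rTensor_lTensor_comm i _) (rTensor_lTensor_comm i _)
    (rTensor_lTensor_comm p _) (rTensor_lTensor_comm p _)).trans ⟨fun h m hm ↦ ?_,
      fun h x hx ↦ (hL x).1 (h _ hx)⟩
  obtain ⟨x, rfl⟩ := e.lTensor_surjective L he m
  exact (hL x).2 (h x hm)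

lemma extVanishes_succ_succ_iff [Module.Projective R F] (hi : Function.Injective i)
    (hip : Function.Exact i p) (hp : Function.Surjective p) (N : ModuleCat.{u} R) (n : ℕ) :
    extVanishes R (ModuleCat.of R C) N (n + 2) ↔ extVanishes R (ModuleCat.of R L) N (n + 1) := by
  let S : ShortComplex (ModuleCat.{u} R) := ShortComplex.mk (ModuleCat.ofHom i)
    (ModuleCat.ofHom p) (ModuleCat.hom_ext hip.linearMap_comp_eq_zero)
  have hS : S.ShortExact := ShortComplex.ShortExact.mk'
    ((ShortComplex.ShortExact.moduleCat_exact_iff_function_exact _).2 hip)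
    ((ModuleCat.mono_iff_injective _).2 hi) ((ModuleCat.epi_iff_surjective _).2 hp)
  have : Projective S.X₂ := inferInstanceAs (Projective (ModuleCat.of R F))
  rw [extVanishes_succ_iff_subsingleton_ext, extVanishes_succ_iff_subsingleton_ext,
    subsingleton_iff_forall_eq 0, subsingleton_iff_forall_eq 0]
  constructor
  · intro h x
    obtain ⟨y, rfl⟩ := Abelian.Ext.contravariant_sequence_exact₁ hS N x (add_comm 1 (n + 1)) (h _)
    rw [Abelian.Ext.eq_zero_of_projective y, Abelian.Ext.comp_zero]
  · intro h x
    obtain ⟨y, rfl⟩ := precomp_extClass_surjective_of_projective_X₂ N hS (n + 1) x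
    rw [h y, map_zero]

lemma extVanishes_one_iff [Module.Projective R F] (hi : Function.Injective i)
    (hip : Function.Exact i p) (hp : Function.Surjective p) (N : ModuleCat.{u} R) :
    extVanishes R (ModuleCat.of R C) N 1 ↔
      ∀ g : L →ₗ[R] N, ∃ h : F →ₗ[R] N, h ∘ₗ i = g := by
  let S : ShortComplex (ModuleCat.{u} R) := ShortComplex.mk (ModuleCat.ofHom i)
    (ModuleCat.ofHom p) (ModuleCat.hom_ext hip.linearMap_comp_eq_zero)
  have hS : S.ShortExact := ShortComplex.ShortExact.mk'
    ((ShortComplex.ShortExact.moduleCat_exact_iff_function_exact _).2 hip)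
    ((ModuleCat.mono_iff_injective _).2 hi) ((ModuleCat.epi_iff_surjective _).2 hp)
  have : Projective S.X₂ := inferInstanceAs (Projective (ModuleCat.of R F))
  rw [extVanishes_succ_iff_subsingleton_ext, subsingleton_iff_forall_eq 0]
  constructor
  · intro h g
    obtain ⟨y, hy⟩ := Abelian.Ext.contravariant_sequence_exact₁ hS N
      (Abelian.Ext.mk₀ (ModuleCat.ofHom g)) (add_comm 1 0) (h _)
    obtain ⟨y, rfl⟩ := (Abelian.Ext.mk₀_bijective _ _).2 y
    rw [Abelian.Ext.mk₀_comp_mk₀] at hy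
    exact ⟨y.hom, congrArg ModuleCat.Hom.hom ((Abelian.Ext.mk₀_bijective _ _).1 hy)⟩
  · intro h x
    obtain ⟨y, rfl⟩ := precomp_extClass_surjective_of_projective_X₂ N hS 0 x
    obtain ⟨y, rfl⟩ := (Abelian.Ext.mk₀_bijective _ _).2 y
    obtain ⟨g, hg⟩ := h y.hom
    obtain rfl : S.f ≫ ModuleCat.ofHom g = y := ModuleCat.hom_ext hg
    rw [← Abelian.Ext.mk₀_comp_mk₀]
    exact hS.extClass_comp_assoc _ (h := add_comm 1 0)

end DimensionShifting

section Purity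

open TensorProduct

variable {R : Type u} [CommRing R]

lemma exists_sum_tmul_eq {C X : Type*} [AddCommGroup C] [Module R C] [AddCommGroup X] [Module R X]
    {n : ℕ} {c : Fin n → C} (hc : Submodule.span R (Set.range c) = ⊤) (z : C ⊗[R] X) :
    ∃ β : Fin n → X, ∑ s, c s ⊗ₜ β s = z := by
  induction z with
  | zero => exact ⟨0, by simp⟩
  | add z w hz hw =>
    obtain ⟨β, rfl⟩ := hz
    obtain ⟨γ, rfl⟩ := hw
    exact ⟨β + γ, by simp [tmul_add, Finset.sum_add_distrib]⟩
  | tmul d z =>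
    obtain ⟨r, rfl⟩ := (Submodule.mem_span_range_iff_exists_fun R).1
      (show d ∈ Submodule.span R (Set.range c) from hc ▸ Submodule.mem_top)
    exact ⟨fun s ↦ r s • z, by simp [sum_tmul, smul_tmul]⟩

lemma sum_tmul_sub_eq {C X : Type*} [AddCommGroup C] [Module R C] [AddCommGroup X] [Module R X]
    {n : ℕ} {ι : Type*} [Fintype ι] (c : Fin n → C) (a : ι → Fin n → R) (A : ι → C)
    (ha : ∀ i, ∑ s, a i s • c s = A i) (x : ι → X) (β : Fin n → X) :
    ∑ s, c s ⊗ₜ[R] (∑ i, a i s • x i - β s) = ∑ i, A i ⊗ₜ x i - ∑ s, c s ⊗ₜ β s := by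
  simp only [tmul_sub, Finset.sum_sub_distrib, tmul_sum, ← smul_tmul, ← ha, sum_tmul]
  rw [Finset.sum_comm]

/-- A linear map `f : N → M` is equationally pure if every finite system of linear equations
with constants in `N` that is solvable in `M` is solvable in `N`. -/
def EquationallyPure {N M : Type*} [AddCommGroup N] [Module R N] [AddCommGroup M] [Module R M]
    (f : N →ₗ[R] M) : Prop :=
  ∀ (m n : ℕ) (A : Fin m → Fin n → R) (b : Fin m → N) (x : Fin n → M),
    (∀ k, ∑ i, A k i • x i = f (b k)) → ∃ y : Fin n → N, ∀ k, ∑ i, A k i • y i = b k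

namespace EquationallyPure

variable {N M : Type*} [AddCommGroup N] [Module R N] [AddCommGroup M] [Module R M]
  {f : N →ₗ[R] M}

lemma exists_solution (hf : EquationallyPure f) {κ ι : Type*} [Fintype κ] [Fintype ι]
    (A : κ → ι → R) (b : κ → N) (x : ι → M) (h : ∀ k, ∑ i, A k i • x i = f (b k)) :
    ∃ y : ι → N, ∀ k, ∑ i, A k i • y i = b k := by
  let eκ := (Fintype.equivFin κ).symm
  let eι := (Fintype.equivFin ι).symm
  obtain ⟨y, hy⟩ := hf _ _ (fun k i ↦ A (eκ k) (eι i)) (b ∘ eκ) (x ∘ eι) fun k ↦ by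
    simpa [eι.sum_comp (fun i ↦ A (eκ k) i • x i)] using h (eκ k)
  refine ⟨y ∘ eι.symm, fun k ↦ ?_⟩
  have := hy (eκ.symm k)
  rw [← eι.sum_comp]
  simpa using this

lemma of_bijective (hf : Function.Bijective f) : EquationallyPure f := by
  intro m n A b x h
  choose y hy using fun i ↦ hf.2 (x i)
  refine ⟨y, fun k ↦ hf.1 ?_⟩
  simp [hy, h]

lemma injective (hf : EquationallyPure f) : Function.Injective f := by
  rw [injective_iff_map_eq_zero]
  intro z hz
  obtain ⟨y, hy⟩ := hf.exists_solution (κ := Unit) (ι := Empty) (fun _ _ ↦ 0) (fun _ ↦ z) nofun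
    (by simp [hz])
  simpa using (hy ()).symm

/-- If a finite system of equations with coefficients in a finite module `C` and constants in
`C ⊗ N` is solvable in `M`, then it is solvable in `N`. -/
lemma exists_tmul_solution (hf : EquationallyPure f) {C : Type*} [AddCommGroup C] [Module R C]
    [Module.Finite R C] {κ ι : Type*} [Fintype κ] [Fintype ι]
    (A : κ → ι → C) (b : κ → C ⊗[R] N) (x : ι → M)
    (h : ∀ k, ∑ i, A k i ⊗ₜ x i = f.lTensor C (b k)) :
    ∃ y : ι → N, ∀ k, ∑ i, A k i ⊗ₜ y i = b k := by
  classical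
  obtain ⟨n, c, hc⟩ := Module.Finite.exists_fin (R := R) (M := C)
  have hA (k i) : ∃ a : Fin n → R, ∑ s, a s • c s = A k i :=
    (Submodule.mem_span_range_iff_exists_fun R).1 (hc ▸ Submodule.mem_top)
  choose a ha using hA
  choose β hβ using fun k ↦ exists_sum_tmul_eq hc (b k)
  have hvan (k : κ) : VanishesTrivially R c (fun s ↦ ∑ i, a k i s • x i - f (β k s)) := by
    apply vanishesTrivially_of_sum_tmul_eq_zero R hc
    rw [sum_tmul_sub_eq c (a k) (A k) (ha k), h, ← hβ]
    simp
  choose q e y hy hec using hvan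
  obtain ⟨w, hw⟩ := hf.exists_solution (κ := κ × Fin n) (ι := ι ⊕ (Σ k, Fin (q k)))
    (fun ks ↦ Sum.elim (fun i ↦ a ks.1 i ks.2)
      (fun l ↦ if l.1 = ks.1 then - e l.1 ks.2 l.2 else 0))
    (fun ks ↦ β ks.1 ks.2) (Sum.elim x (fun l ↦ y l.1 l.2)) (by
      rintro ⟨k, s⟩
      have := hy k s
      simp only [Fintype.sum_sum_type, Sum.elim_inl, Sum.elim_inr, Fintype.sum_sigma, ite_smul,
        zero_smul, Finset.sum_ite_irrel, Finset.sum_const_zero, Finset.sum_ite_eq',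
        Finset.mem_univ, if_true, neg_smul, Finset.sum_neg_distrib, ← this]
      abel)
  refine ⟨fun i ↦ w (.inl i), fun k ↦ ?_⟩
  rw [← hβ, ← sub_eq_zero, ← sum_tmul_sub_eq c (a k) (A k) (ha k)]
  apply sum_tmul_eq_zero_of_vanishesTrivially
  refine ⟨q k, e k, fun j ↦ w (.inr ⟨k, j⟩), fun s ↦ ?_, hec k⟩
  have := hw (k, s)
  simp only [Fintype.sum_sum_type, Sum.elim_inl, Sum.elim_inr, Fintype.sum_sigma, ite_smul,
    zero_smul, Finset.sum_ite_irrel, Finset.sum_const_zero, Finset.sum_ite_eq',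
    Finset.mem_univ, if_true, neg_smul, Finset.sum_neg_distrib] at this
  beta_reduce
  rw [← this]
  abel

lemma lTensor (hf : EquationallyPure f) (C : Type*) [AddCommGroup C] [Module R C]
    [Module.Finite R C] : EquationallyPure (f.lTensor C) := by
  intro m n A b x h
  obtain ⟨q, c, hc⟩ := Module.Finite.exists_fin (R := R) (M := C)
  choose ξ hξ using fun i ↦ exists_sum_tmul_eq hc (x i)
  obtain ⟨y, hy⟩ := hf.exists_tmul_solution (fun k (l : Fin n × Fin q) ↦ A k l.1 • c l.2) b
    (fun l ↦ ξ l.1 l.2) fun k ↦ by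
      simp only [← h, Fintype.sum_prod_type, ← hξ, Finset.smul_sum, smul_tmul']
  exact ⟨fun i ↦ ∑ s, c s ⊗ₜ y (i, s), fun k ↦ by
    simp only [← hy, Fintype.sum_prod_type, Finset.smul_sum, smul_tmul']⟩

lemma exists_extension (hf : EquationallyPure f) {L F : Type*} [AddCommGroup L] [Module R L]
    [AddCommGroup F] [Module R F] [Module.Finite R L] [Module.Free R F] [Module.Finite R F]
    (i : L →ₗ[R] F) (g : L →ₗ[R] N) (h : F →ₗ[R] M) (hgh : h ∘ₗ i = f ∘ₗ g) :
    ∃ h' : F →ₗ[R] N, h' ∘ₗ i = g := by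
  let B := Module.Free.chooseBasis R F
  obtain ⟨n, l, hl⟩ := Module.Finite.exists_fin (R := R) (M := L)
  obtain ⟨y, hy⟩ := hf.exists_solution (fun k s ↦ B.repr (i (l k)) s) (g ∘ l) (h ∘ B) fun k ↦ by
    have := LinearMap.congr_fun hgh (l k)
    simp only [LinearMap.comp_apply] at this
    simp only [Function.comp_apply, ← this, ← map_smul, ← map_sum, B.sum_repr]
  refine ⟨B.constr R y, LinearMap.ext_on_range hl fun k ↦ ?_⟩
  simpa [Module.Basis.constr_apply_fintype] using hy k

end EquationallyPure

end Purity

section Syzygy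

open TensorProduct

variable {R : Type u} [CommRing R]

lemma exists_submodule_exact_surjective (C : Type u) [AddCommGroup C] [Module R C]
    [Module.Finite R C] : ∃ (n : ℕ) (L : Submodule R (Fin n → R)) (p : (Fin n → R) →ₗ[R] C),
      Function.Exact L.subtype p ∧ Function.Surjective p := by
  obtain ⟨n, p, hp⟩ := Module.Finite.exists_fin' R C
  exact ⟨n, p.ker, p, LinearMap.exact_subtype_ker_map p, hp⟩

lemma piRightHom_surjective (C : Type*) [AddCommGroup C] [Module R C] [Module.Finite R C]
    {ι : Type*} (M : ι → Type*) [∀ i, AddCommGroup (M i)] [∀ i, Module R (M i)] :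
    Function.Surjective (TensorProduct.piRightHom R R C M) := by
  obtain ⟨n, c, hc⟩ := Module.Finite.exists_fin (R := R) (M := C)
  intro z
  choose β hβ using fun i ↦ exists_sum_tmul_eq hc (z i)
  refine ⟨∑ s, c s ⊗ₜ fun i ↦ β i s, ?_⟩
  ext i
  simp [← hβ]

lemma piRightHom_rTensor {L C : Type*} [AddCommGroup L] [Module R L] [AddCommGroup C] [Module R C]
    {ι : Type*} (M : ι → Type*) [∀ i, AddCommGroup (M i)] [∀ i, Module R (M i)]
    (f : L →ₗ[R] C) (x : L ⊗[R] (∀ i, M i)) (i : ι) :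
    TensorProduct.piRightHom R R C M (f.rTensor _ x) i =
      f.rTensor (M i) (TensorProduct.piRightHom R R L M x i) := by
  induction x with
  | zero => simp
  | add x y hx hy => simp [hx, hy]
  | tmul l m => simp

lemma piRightHom_pi_injective (n : ℕ)
    {ι : Type*} (M : ι → Type*) [∀ i, AddCommGroup (M i)] [∀ i, Module R (M i)] :
    Function.Injective (TensorProduct.piRightHom R R (Fin n → R) M) := by
  rw [injective_iff_map_eq_zero]
  intro z hz
  obtain ⟨β, rfl⟩ := exists_sum_tmul_eq (Pi.basisFun R (Fin n)).span_eq z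
  have (s : Fin n) : β s = 0 := by
    ext i
    have := congr_arg (fun z ↦ TensorProduct.lid R _ ((LinearMap.proj s).rTensor (M i) (z i))) hz
    simpa [Pi.single_apply, ite_smul] using this
  simp [this]

lemma piRightHom_injective [IsNoetherianRing R] (C : Type u) [AddCommGroup C] [Module R C]
    [Module.Finite R C]
    {ι : Type*} (M : ι → Type*) [∀ i, AddCommGroup (M i)] [∀ i, Module R (M i)] :
    Function.Injective (TensorProduct.piRightHom R R C M) := by
  obtain ⟨n, L, p, hLp, hp⟩ := exists_submodule_exact_surjective (R := R) C
  rw [injective_iff_map_eq_zero]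
  intro z hz
  obtain ⟨z, rfl⟩ := LinearMap.rTensor_surjective _ hp z
  have (i : ι) : ∃ y : L ⊗[R] M i, L.subtype.rTensor (M i) y = piRightHom R R _ M z i :=
    (rTensor_exact (M i) hLp hp _).1 (by rw [← piRightHom_rTensor, hz]; rfl)
  choose y hy using this
  obtain ⟨w, rfl⟩ := piRightHom_surjective L M y
  have : L.subtype.rTensor _ w = z := piRightHom_pi_injective n M <| by
    ext i : 1
    rw [piRightHom_rTensor, hy]
  rw [← this]
  exact (rTensor_exact _ hLp hp).apply_apply_eq_zero w

variable [IsNoetherianRing R]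

lemma EquationallyPure.torVanishes {N M : Type u} [AddCommGroup N] [Module R N] [AddCommGroup M]
    [Module R M] {f : N →ₗ[R] M} (hf : EquationallyPure f) (j : ℕ)
    (C : Type u) [AddCommGroup C] [Module R C] [Module.Finite R C]
    (h : torVanishes R (.of R C) (.of R M) (j + 1)) :
    torVanishes R (.of R C) (.of R N) (j + 1) := by
  obtain ⟨n, L, p, hLp, hp⟩ := exists_submodule_exact_surjective (R := R) C
  induction j generalizing C n with
  | zero =>
    rw [torVanishes_one_iff L.injective_subtype hLp hp] at h ⊢
    refine fun x y hxy ↦ (hf.lTensor L).injective (h ?_)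
    simp [rTensor_lTensor_comm, hxy]
  | succ j ih =>
    rw [torVanishes_succ_succ_iff L.injective_subtype hLp hp] at h ⊢
    obtain ⟨n', L', p', hLp', hp'⟩ := exists_submodule_exact_surjective (R := R) L
    exact ih _ h _ _ _ hLp' hp'

lemma torVanishes_pi {ι : Type u} (M : ι → Type u) [∀ i, AddCommGroup (M i)] [∀ i, Module R (M i)]
    (j : ℕ) (C : Type u) [AddCommGroup C] [Module R C] [Module.Finite R C]
    (h : ∀ i, torVanishes R (.of R C) (.of R (M i)) (j + 1)) :
    torVanishes R (.of R C) (.of R (∀ i, M i)) (j + 1) := by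
  obtain ⟨n, L, p, hLp, hp⟩ := exists_submodule_exact_surjective (R := R) C
  induction j generalizing C n with
  | zero =>
    simp only [zero_add, torVanishes_one_iff L.injective_subtype hLp hp] at h ⊢
    refine fun x y hxy ↦ piRightHom_injective L M (funext fun i ↦ h i ?_)
    rw [← piRightHom_rTensor, ← piRightHom_rTensor, hxy]
  | succ j ih =>
    simp only [torVanishes_succ_succ_iff L.injective_subtype hLp hp] at h ⊢
    obtain ⟨n', L', p', hLp', hp'⟩ := exists_submodule_exact_surjective (R := R) L
    exact ih _ h _ _ _ hLp' hp'

lemma EquationallyPure.extVanishes {N M : Type u} [AddCommGroup N] [Module R N] [AddCommGroup M]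
    [Module R M] {f : N →ₗ[R] M} (hf : EquationallyPure f) (j : ℕ)
    (C : Type u) [AddCommGroup C] [Module R C] [Module.Finite R C]
    (h : extVanishes R (.of R C) (.of R M) (j + 1)) :
    extVanishes R (.of R C) (.of R N) (j + 1) := by
  obtain ⟨n, L, p, hLp, hp⟩ := exists_submodule_exact_surjective (R := R) C
  induction j generalizing C n with
  | zero =>
    rw [extVanishes_one_iff L.injective_subtype hLp hp] at h ⊢
    intro g
    obtain ⟨h', hh'⟩ := h (f ∘ₗ g)
    exact hf.exists_extension _ _ h' hh'
  | succ j ih =>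
    rw [extVanishes_succ_succ_iff L.injective_subtype hLp hp] at h ⊢
    obtain ⟨n', L', p', hLp', hp'⟩ := exists_submodule_exact_surjective (R := R) L
    exact ih _ h _ _ _ hLp' hp'

lemma extVanishes_pi {ι : Type u} (M : ι → Type u) [∀ i, AddCommGroup (M i)] [∀ i, Module R (M i)]
    (j : ℕ) (C : Type u) [AddCommGroup C] [Module R C] [Module.Finite R C]
    (h : ∀ i, extVanishes R (.of R C) (.of R (M i)) (j + 1)) :
    extVanishes R (.of R C) (.of R (∀ i, M i)) (j + 1) := by
  obtain ⟨n, L, p, hLp, hp⟩ := exists_submodule_exact_surjective (R := R) C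
  induction j generalizing C n with
  | zero =>
    simp only [zero_add, extVanishes_one_iff L.injective_subtype hLp hp] at h ⊢
    intro g
    choose h' hh' using fun i ↦ h i (LinearMap.proj i ∘ₗ g)
    refine ⟨LinearMap.pi h', LinearMap.ext fun x ↦ funext fun i ↦ ?_⟩
    simpa using LinearMap.congr_fun (hh' i) x
  | succ j ih =>
    simp only [extVanishes_succ_succ_iff L.injective_subtype hLp hp] at h ⊢
    obtain ⟨n', L', p', hLp', hp'⟩ := exists_submodule_exact_surjective (R := R) L
    exact ih _ h _ _ _ hLp' hp'

end Syzygy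

section Auslander

open TensorProduct

variable {R : Type u} [CommRing R] [IsNoetherianRing R] {C : Type u} [AddCommGroup C] [Module R C]
  [Module.Finite R C]

lemma EquationallyPure.memAuslander {N M : Type u} [AddCommGroup N] [Module R N] [AddCommGroup M]
    [Module R M] {f : N →ₗ[R] M} (hf : EquationallyPure f) (hM : memAuslander R C (.of R M)) :
    memAuslander R C (.of R N) := by
  obtain ⟨htor, hext, hinj, hsurj⟩ := hM
  refine ⟨?_, ?_, ?_, ?_⟩
  · rintro (_ | j) hj
    · exact absurd hj (lt_irrefl 0)
    · exact hf.torVanishes j C (htor _ hj)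
  · rintro (_ | j) hj
    · exact absurd hj (lt_irrefl 0)
    · exact (hf.lTensor C).extVanishes j C (hext _ hj)
  · intro x y hxy
    refine hf.injective (hinj (LinearMap.ext fun c ↦ ?_))
    simpa [etaMap] using congr_arg (fun g ↦ f.lTensor C (g c)) hxy
  · intro g
    obtain ⟨n, c, hc⟩ := Module.Finite.exists_fin (R := R) (M := C)
    obtain ⟨x, hx⟩ := hsurj (f.lTensor C ∘ₗ g)
    obtain ⟨y, hy⟩ := hf.exists_tmul_solution (ι := Unit) (fun k _ ↦ c k) (fun k ↦ g (c k))
      (fun _ ↦ x) fun k ↦ by simpa [etaMap] using LinearMap.congr_fun hx (c k)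
    exact ⟨y (), LinearMap.ext_on_range hc fun k ↦ by simpa [etaMap] using hy k⟩

lemma memAuslander_pi {ι : Type u} (M : ι → Type u) [∀ i, AddCommGroup (M i)]
    [∀ i, Module R (M i)] (hM : ∀ i, memAuslander R C (.of R (M i))) :
    memAuslander R C (.of R (∀ i, M i)) := by
  have hbij : Function.Bijective (piRightHom R R C M) :=
    ⟨piRightHom_injective C M, piRightHom_surjective C M⟩
  refine ⟨?_, ?_, ?_, ?_⟩
  · rintro (_ | j) hj
    · exact absurd hj (lt_irrefl 0)
    · exact torVanishes_pi M j C fun i ↦ (hM i).1 _ hj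
  · rintro (_ | j) hj
    · exact absurd hj (lt_irrefl 0)
    · exact (EquationallyPure.of_bijective hbij).extVanishes j C
        (extVanishes_pi (fun i ↦ C ⊗[R] M i) j C fun i ↦ (hM i).2.1 _ hj)
  · intro x y hxy
    refine funext fun i ↦ (hM i).2.2.1 (LinearMap.ext fun c ↦ ?_)
    simpa [etaMap] using congr_arg (fun g ↦ piRightHom R R C M (g c) i) hxy
  · intro g
    choose m hm using fun i ↦ (hM i).2.2.2 (LinearMap.proj i ∘ₗ piRightHom R R C M ∘ₗ g)
    refine ⟨m, LinearMap.ext fun c ↦ hbij.1 (funext fun i ↦ ?_)⟩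
    simpa [etaMap] using LinearMap.congr_fun (hm i) c

end Auslander

section Preenvelope

variable {R : Type u} [CommRing R]

/-- Terms built from elements of `M` by linear combinations and by the components of chosen
solutions of finite systems of linear equations. -/
inductive PureTerm (R M : Type u) : Type u
  | of (m : M)
  | lin (n : ℕ) (c : Fin n → R) (t : Fin n → PureTerm R M)
  | sol (m n : ℕ) (A : Fin m → Fin n → R) (t : Fin m → PureTerm R M) (i : Fin n)

open Classical in
/-- The value of a term in a module `F` under an interpretation of `M` in `F`. -/
noncomputable def PureTerm.eval {M F : Type u} [AddCommGroup F] [Module R F] (f : M → F) :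
    PureTerm R M → F
  | of m => f m
  | lin _ c t => ∑ i, c i • (t i).eval f
  | sol _ _ A t i =>
    if h : ∃ x : _ → F, ∀ k, ∑ i, A k i • x i = (t k).eval f then h.choose i else 0

/-- The values of all terms form a submodule. -/
def pureHull {M F : Type u} [AddCommGroup F] [Module R F] (f : M → F) : Submodule R F where
  carrier := Set.range (PureTerm.eval (R := R) f)
  add_mem' := by
    rintro _ _ ⟨s, rfl⟩ ⟨t, rfl⟩
    exact ⟨.lin 2 1 ![s, t], by simp [PureTerm.eval]⟩
  zero_mem' := ⟨.lin 0 0 ![], by simp [PureTerm.eval]⟩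
  smul_mem' := by
    rintro r _ ⟨t, rfl⟩
    exact ⟨.lin 1 ![r] ![t], by simp [PureTerm.eval]⟩

lemma pureHull_pure {M F : Type u} [AddCommGroup F] [Module R F] (f : M → F) :
    EquationallyPure (pureHull (R := R) f).subtype := by
  intro m n A b x h
  choose t ht using fun k ↦ (b k).2
  have hsol : ∃ x : Fin n → F, ∀ k, ∑ i, A k i • x i = (t k).eval f := ⟨x, by simpa [ht] using h⟩
  refine ⟨fun i ↦ ⟨hsol.choose i, .sol m n A t i, by rw [PureTerm.eval, dif_pos hsol]⟩,
    fun k ↦ Subtype.ext ?_⟩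
  simpa [ht] using hsol.choose_spec k

/-- A module of a class `𝓕` whose underlying type is a quotient of `PureTerm R M`, together with
a linear map from `M`. -/
structure PureTermQuotient (𝓕 : Set (ModuleCat.{u} R)) (M : Type u) [AddCommGroup M]
    [Module R M] : Type u where
  setoid : Setoid (PureTerm R M)
  addCommGroup : AddCommGroup (Quotient setoid)
  moduleInst : Module R (Quotient setoid)
  map : M →ₗ[R] Quotient setoid
  mem : ModuleCat.of R (Quotient setoid) ∈ 𝓕

attribute [instance] PureTermQuotient.addCommGroup PureTermQuotient.moduleInst

/-- A class of modules closed under pure submodules and products is preenveloping. -/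
theorem preenveloping_of_pure_of_pi (𝓕 : Set (ModuleCat.{u} R))
    (hpure : ∀ (N M : Type u) [AddCommGroup N] [Module R N] [AddCommGroup M] [Module R M]
      (f : N →ₗ[R] M), EquationallyPure f → ModuleCat.of R M ∈ 𝓕 → ModuleCat.of R N ∈ 𝓕)
    (hpi : ∀ (ι : Type u) (M : ι → Type u) [∀ i, AddCommGroup (M i)] [∀ i, Module R (M i)],
      (∀ i, ModuleCat.of R (M i) ∈ 𝓕) → ModuleCat.of R (∀ i, M i) ∈ 𝓕) :
    Preenveloping R 𝓕 := by
  intro M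
  refine ⟨.of R (∀ q : PureTermQuotient 𝓕 M, Quotient q.setoid),
    ModuleCat.ofHom (LinearMap.pi fun q ↦ q.map), hpi _ _ fun q ↦ q.mem, fun F hF φ ↦ ?_⟩
  let N := pureHull (R := R) φ.hom
  have hN : ModuleCat.of R N ∈ 𝓕 := hpure N F _ (pureHull_pure _) hF
  let e : Quotient (Setoid.ker (Set.rangeFactorization (PureTerm.eval (R := R) φ.hom))) ≃ N :=
    Setoid.quotientKerEquivOfSurjective _ Set.rangeFactorization_surjective
  let _ := e.addCommGroup
  let _ := e.module R
  let l := e.linearEquiv R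
  let g : M →ₗ[R] N := φ.hom.codRestrict N fun m ↦ ⟨.of m, rfl⟩
  let q : PureTermQuotient 𝓕 M :=
    { setoid := _
      addCommGroup := _
      moduleInst := _
      map := l.symm.toLinearMap ∘ₗ g
      mem := hpure _ N l.toLinearMap (.of_bijective l.bijective) hN }
  refine ⟨ModuleCat.ofHom (N.subtype ∘ₗ l.toLinearMap ∘ₗ LinearMap.proj q), ?_⟩
  ext m
  exact congr_arg N.subtype (l.apply_symm_apply (g m))

end Preenvelope
/-- If `C` is a semidualizing module over a commutative noetherian ring `R`, then the
Auslander class `A_C` is preenveloping: every `R`-module has an `A_C`-preenvelope. -/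
theorem auslanderClass_preenveloping
    (R : Type u) [CommRing R] [IsNoetherianRing R]
    (C : Type u) [AddCommGroup C] [Module R C] (hC : IsSemidualizing R C) :
    Preenveloping R (auslanderClass R C) := by
  have := hC.1
  exact preenveloping_of_pure_of_pi _ (fun _ _ _ _ _ _ _ hf hM ↦ hf.memAuslander hM)
    fun _ M _ _ hM ↦ memAuslander_pi M hM
end
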